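/- Let f_α be the intermittent map with α ≥ 1, and let x̃ ∈ (1/2,1]. Then for Lebesgue-almost every x ∈ S¹, lim_{r→0} log τ_r(x,x̃)/(−log r) = max(1,α) = α, where τ_r(x,x̃) = min{n ≥ 1 : d(f_α^n(x), x̃) < r} is the first hitting time of the orbit of x to the ball of radius r around x̃. -/

import Mathlib

open MeasureTheory Filter Set Real

noncomputable section

/-- The Liverani–Saussol–Vaienti intermittent map on `S¹ = [0,1)`:
`f_α(x) = x(1 + 2^α x^α)` for `x < 1/2` and `f_α(x) = 2x − 1` for `x ≥ 1/2`. -/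
def lsv (a : ℝ) (x : ℝ) : ℝ :=
  if x < 1 / 2 then x * (1 + 2 ^ a * x ^ a) else 2 * x - 1

/-- The circle distance on `S¹ = [0,1)`: `d(x,y) = min(|x−y|, 1−|x−y|)`. -/
def circDist (x y : ℝ) : ℝ := min |x - y| (1 - |x - y|)

/-- Maximum process `M_n(x) = max_{0 ≤ k ≤ n-1} φ(f^k x)`. -/
def maxProc {X : Type*} (f : X → X) (φ : X → ℝ) (n : ℕ) (x : X) : ℝ :=
  ⨆ k : Fin n, φ (f^[k] x)

/-- First hitting time of the orbit of `x` to the ball of radius `r`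
around `x̃` (in the circle metric). -/
def hitBall (f : ℝ → ℝ) (xt r : ℝ) (x : ℝ) : ℕ :=
  sInf {n : ℕ | 1 ≤ n ∧ circDist (f^[n] x) xt < r}

/-- The left branch. -/
def lsvL (a x : ℝ) : ℝ := x * (1 + 2 ^ a * x ^ a)

lemma lsv_left {a x : ℝ} (hx : x < 1 / 2) : lsv a x = lsvL a x := by
  simp only [lsv, lsvL, if_pos hx]

lemma lsv_right {a x : ℝ} (hx : 1 / 2 ≤ x) : lsv a x = 2 * x - 1 := by
  simp only [lsv, if_neg (not_lt.mpr hx)]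

lemma lsvL_sub {a x y : ℝ} (ha : 1 ≤ a) (hx : 0 ≤ x) (hxy : x ≤ y) :
    y - x ≤ lsvL a y - lsvL a x := by
  have h1 : x ^ a ≤ y ^ a := Real.rpow_le_rpow hx hxy (by linarith)
  have h2 : (0:ℝ) ≤ x ^ a := Real.rpow_nonneg hx a
  have h3 : (0:ℝ) < 2 ^ a := Real.rpow_pos_of_pos two_pos a
  have h4 : x * x ^ a ≤ y * y ^ a := mul_le_mul hxy h1 h2 (hx.trans hxy)
  unfold lsvL
  nlinarith [mul_le_mul_of_nonneg_left h4 h3.le]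

lemma lsvL_half {a : ℝ} : lsvL a (1 / 2) = 1 := by
  unfold lsvL
  rw [← Real.mul_rpow (by norm_num) (by norm_num)]
  norm_num

lemma lsvL_zero {a : ℝ} : lsvL a 0 = 0 := by simp [lsvL]

lemma lsvL_continuous {a : ℝ} (ha : 1 ≤ a) : Continuous (lsvL a) := by
  unfold lsvL
  have : Continuous (fun x : ℝ => x ^ a) := Real.continuous_rpow_const (by linarith)
  fun_prop

lemma lsvL_hasDerivAt {a x : ℝ} (hx : 0 < x) :
    HasDerivAt (lsvL a) (1 + (1 + a) * (2 ^ a * x ^ a)) x := by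
  have h1 : HasDerivAt (fun y : ℝ => y ^ a) (a * x ^ (a - 1)) x :=
    Real.hasDerivAt_rpow_const (Or.inl hx.ne')
  have h2 := (hasDerivAt_id x).mul ((h1.const_mul ((2:ℝ) ^ a)).const_add 1)
  have h3 : x * x ^ (a - 1) = x ^ a := by
    rw [Real.rpow_sub_one hx.ne']; field_simp
  convert! h2 using 1
  simp only [id]
  rw [← h3]; ring

lemma lsvL_mem {a x : ℝ} (ha : 1 ≤ a) (hx : x ∈ Ioo (0:ℝ) (1 / 2)) : lsvL a x ∈ Ioo (0:ℝ) 1 := by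
  have h1 := lsvL_sub ha le_rfl hx.1.le
  have h2 := lsvL_sub ha hx.1.le hx.2.le
  rw [lsvL_zero] at h1
  rw [lsvL_half] at h2
  constructor <;> linarith [hx.1, hx.2]

lemma exists_inv {a : ℝ} (ha : 1 ≤ a) (y : ℝ) (hy : y ∈ Ioo (0:ℝ) 1) :
    ∃ x ∈ Ioo (0:ℝ) (1 / 2), lsvL a x = y := by
  have := intermediate_value_Ioo (a := (0:ℝ)) (b := 1 / 2) (by norm_num)
    (lsvL_continuous ha).continuousOn
  rw [lsvL_zero, lsvL_half] at this
  exact this hy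

open Classical in
/-- Inverse of the left branch. -/
def phi0 (a y : ℝ) : ℝ :=
  if h : ∃ x ∈ Ioo (0:ℝ) (1 / 2), lsvL a x = y then h.choose else 0

/-- Inverse of the right branch. -/
def phi1 (y : ℝ) : ℝ := (1 + y) / 2

abbrev II : Set ℝ := Ioo (0:ℝ) 1

lemma phi0_mem {a y : ℝ} (ha : 1 ≤ a) (hy : y ∈ II) : phi0 a y ∈ Ioo (0:ℝ) (1 / 2) := by
  have h := exists_inv ha y hy
  simp only [phi0, dif_pos h]
  exact h.choose_spec.1

lemma lsvL_phi0 {a y : ℝ} (ha : 1 ≤ a) (hy : y ∈ II) : lsvL a (phi0 a y) = y := by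
  have h := exists_inv ha y hy
  simp only [phi0, dif_pos h]
  exact h.choose_spec.2

lemma phi0_memI {a y : ℝ} (ha : 1 ≤ a) (hy : y ∈ II) : phi0 a y ∈ II := by
  have := phi0_mem ha hy
  exact ⟨this.1, by linarith [this.2]⟩

lemma phi1_memI {y : ℝ} (hy : y ∈ II) : phi1 y ∈ II := by
  unfold phi1
  constructor <;> linarith [hy.1, hy.2]

lemma phi1_gt {y : ℝ} (hy : y ∈ II) : 1 / 2 < phi1 y := by
  unfold phi1
  linarith [hy.1, hy.2]

lemma lsvL_inj {a x y : ℝ} (ha : 1 ≤ a) (hx : 0 ≤ x) (hy : 0 ≤ y) (h : lsvL a x = lsvL a y) :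
    x = y := by
  rcases le_total x y with h1 | h1
  · have := lsvL_sub ha hx h1
    linarith
  · have := lsvL_sub ha hy h1
    linarith

lemma phi0_lsvL {a x : ℝ} (ha : 1 ≤ a) (hx : x ∈ Ioo (0:ℝ) (1 / 2)) : phi0 a (lsvL a x) = x := by
  have h := lsvL_mem ha hx
  exact lsvL_inj ha (phi0_mem ha h).1.le hx.1.le (lsvL_phi0 ha h)

lemma phi0_lip {a y z : ℝ} (ha : 1 ≤ a) (hy : y ∈ II) (hz : z ∈ II) :
    |phi0 a y - phi0 a z| ≤ |y - z| := by
  have e1 := lsvL_phi0 ha hy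
  have e2 := lsvL_phi0 ha hz
  rcases le_total (phi0 a y) (phi0 a z) with h | h
  · have := lsvL_sub ha (phi0_mem ha hy).1.le h
    rw [e1, e2] at this
    rw [abs_of_nonpos (by linarith), abs_of_nonpos (by linarith)]
    linarith
  · have := lsvL_sub ha (phi0_mem ha hz).1.le h
    rw [e1, e2] at this
    rw [abs_of_nonneg (by linarith), abs_of_nonneg (by linarith)]
    linarith

lemma phi0_mono {a y z : ℝ} (ha : 1 ≤ a) (hy : y ∈ II) (hz : z ∈ II) (hyz : y ≤ z) :
    phi0 a y ≤ phi0 a z := by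
  by_contra h
  have := lsvL_sub ha (phi0_mem ha hz).1.le (not_le.mp h).le
  rw [lsvL_phi0 ha hy, lsvL_phi0 ha hz] at this
  linarith

lemma phi0_continuousAt {a y : ℝ} (ha : 1 ≤ a) (hy : y ∈ II) : ContinuousAt (phi0 a) y := by
  rw [Metric.continuousAt_iff]
  intro ε hε
  obtain ⟨δ, hδ, hb⟩ := Metric.isOpen_iff.mp isOpen_Ioo y hy
  refine ⟨min ε δ, lt_min hε hδ, fun {z} hz => ?_⟩
  have hzI : z ∈ II := hb (lt_of_lt_of_le hz (min_le_right _ _))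
  rw [Real.dist_eq] at hz ⊢
  exact (phi0_lip ha hzI hy).trans_lt (lt_of_lt_of_le hz (min_le_left _ _))

/-- Derivative of the inverse left branch. -/
def dphi0 (a y : ℝ) : ℝ := (1 + (1 + a) * (2 ^ a * (phi0 a y) ^ a))⁻¹

lemma phi0_hasDerivAt {a y : ℝ} (ha : 1 ≤ a) (hy : y ∈ II) :
    HasDerivAt (phi0 a) (dphi0 a y) y := by
  have h0 := (phi0_mem ha hy).1
  refine HasDerivAt.of_local_left_inverse (phi0_continuousAt ha hy) (lsvL_hasDerivAt h0) ?_ ?_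
  · have : (0:ℝ) < 2 ^ a * (phi0 a y) ^ a := by positivity
    have : (0:ℝ) < 1 + (1 + a) * (2 ^ a * (phi0 a y) ^ a) := by nlinarith
    exact this.ne'
  · filter_upwards [isOpen_Ioo.mem_nhds hy] with z hz
    exact lsvL_phi0 ha hz

/-- Admissible inverse branches. -/
structure Ad (a : ℝ) (ψ ψ' : ℝ → ℝ) : Prop where
  hd : ∀ y ∈ II, HasDerivAt ψ (ψ' y) y
  pos : ∀ y ∈ II, 0 < ψ' y
  anti : ∀ y ∈ II, ∀ z ∈ II, y ≤ z → ψ' z ≤ ψ' y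
  mono : ∀ y ∈ II, ∀ z ∈ II, y ≤ z → y ^ (1 + a) * ψ' y ≤ z ^ (1 + a) * ψ' z

def Adm (a : ℝ) (ψ : ℝ → ℝ) : Prop := ∃ ψ', Ad a ψ ψ'

lemma Adm.id {a : ℝ} (ha : 1 ≤ a) : Adm a id := by
  refine ⟨fun _ => 1, fun y _ => hasDerivAt_id y, fun _ _ => one_pos, fun _ _ _ _ _ => le_rfl, ?_⟩
  intro y hy z hz hyz
  simp only [mul_one]
  exact Real.rpow_le_rpow hy.1.le hyz (by linarith)

/-- General composition lemma. -/
lemma Ad.comp {a : ℝ} {ψ ψ' φ φ' : ℝ → ℝ} (h : Ad a ψ ψ')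
    (hm : ∀ y ∈ II, φ y ∈ II) (hmono : ∀ y ∈ II, ∀ z ∈ II, y ≤ z → φ y ≤ φ z)
    (hd : ∀ y ∈ II, HasDerivAt φ (φ' y) y) (hpos : ∀ y ∈ II, 0 < φ' y)
    (hanti : ∀ y ∈ II, ∀ z ∈ II, y ≤ z → φ' z ≤ φ' y)
    (hinc : ∀ y ∈ II, ∀ z ∈ II, y ≤ z →
      (y / φ y) ^ (1 + a) * φ' y ≤ (z / φ z) ^ (1 + a) * φ' z) :
    Ad a (ψ ∘ φ) (fun y => ψ' (φ y) * φ' y) := by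
  refine ⟨fun y hy => (h.hd _ (hm y hy)).comp y (hd y hy),
    fun y hy => mul_pos (h.pos _ (hm y hy)) (hpos y hy), ?_, ?_⟩
  · intro y hy z hz hyz
    exact mul_le_mul (h.anti _ (hm y hy) _ (hm z hz) (hmono y hy z hz hyz)) (hanti y hy z hz hyz)
      (hpos z hz).le (h.pos _ (hm y hy)).le
  · intro y hy z hz hyz
    have key : ∀ y ∈ II, y ^ (1 + a) * (ψ' (φ y) * φ' y)
        = ((φ y) ^ (1 + a) * ψ' (φ y)) * ((y / φ y) ^ (1 + a) * φ' y) := by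
      intro y hy
      have h1 := (hm y hy).1
      have : y ^ (1 + a) = (φ y) ^ (1 + a) * (y / φ y) ^ (1 + a) := by
        rw [← Real.mul_rpow h1.le (div_nonneg hy.1.le h1.le)]
        congr 1
        field_simp
      rw [this]; ring
    rw [key y hy, key z hz]
    refine mul_le_mul (h.mono _ (hm y hy) _ (hm z hz) (hmono y hy z hz hyz)) (hinc y hy z hz hyz)
      ?_ ?_
    · exact mul_nonneg (Real.rpow_nonneg (div_nonneg hy.1.le (hm y hy).1.le) _) (hpos y hy).le
    · exact mul_nonneg (Real.rpow_nonneg (hm z hz).1.le _) (h.pos _ (hm z hz)).le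

lemma phi1_hasDerivAt (y : ℝ) : HasDerivAt phi1 (1 / 2) y := by
  have := ((hasDerivAt_id y).const_add 1).div_const 2
  exact this

lemma Adm.comp1 {a : ℝ} (ha : 1 ≤ a) {ψ : ℝ → ℝ} (h : Adm a ψ) : Adm a (ψ ∘ phi1) := by
  obtain ⟨ψ', h⟩ := h
  refine ⟨_, h.comp (φ' := fun _ => 1 / 2) (fun y hy => phi1_memI hy) ?_
    (fun y _ => phi1_hasDerivAt y) (fun _ _ => by norm_num) (fun _ _ _ _ _ => le_rfl) ?_⟩
  · intro y _ z _ hyz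
    unfold phi1; linarith
  · intro y hy z hz hyz
    refine mul_le_mul_of_nonneg_right ?_ (by norm_num)
    refine Real.rpow_le_rpow (div_nonneg hy.1.le (phi1_memI hy).1.le) ?_ (by linarith)
    rw [div_le_div_iff₀ (phi1_memI hy).1 (phi1_memI hz).1]
    unfold phi1
    nlinarith

lemma phi0_aux {a v1 v2 : ℝ} (ha : 1 ≤ a) (h1 : 0 ≤ v1) (h12 : v1 ≤ v2) :
    (1 + v1) ^ (1 + a) * (1 + (1 + a) * v1)⁻¹ ≤ (1 + v2) ^ (1 + a) * (1 + (1 + a) * v2)⁻¹ := by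
  have p1 : 0 < 1 + (1 + a) * v1 := by nlinarith
  have p2 : 0 < 1 + (1 + a) * v2 := by nlinarith
  have q1 : 0 < 1 + v1 := by linarith
  have B := one_add_mul_self_le_rpow_one_add (s := (v2 - v1) / (1 + v1)) (p := 1 + a)
    (by have : 0 ≤ (v2 - v1) / (1 + v1) := div_nonneg (by linarith) q1.le
        linarith) (by linarith)
  have e : 1 + (v2 - v1) / (1 + v1) = (1 + v2) / (1 + v1) := by field_simp; ring
  rw [e, Real.div_rpow (by linarith) q1.le, le_div_iff₀ (Real.rpow_pos_of_pos q1 _)] at B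
  have C : (1 + (1 + a) * v2) / (1 + (1 + a) * v1) ≤ 1 + (1 + a) * ((v2 - v1) / (1 + v1)) := by
    have : (1 + (1 + a) * v2) / (1 + (1 + a) * v1)
        = 1 + (1 + a) * ((v2 - v1) / (1 + (1 + a) * v1)) := by field_simp; ring
    rw [this]
    have : (v2 - v1) / (1 + (1 + a) * v1) ≤ (v2 - v1) / (1 + v1) :=
      div_le_div_of_nonneg_left (by linarith) q1 (by nlinarith)
    nlinarith
  have D := (mul_le_mul_of_nonneg_right C (Real.rpow_pos_of_pos q1 (1 + a)).le).trans B
  rw [← div_eq_mul_inv, ← div_eq_mul_inv, div_le_div_iff₀ p1 p2]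
  rw [div_mul_eq_mul_div, div_le_iff₀ p1] at D
  linarith

lemma Adm.comp0 {a : ℝ} (ha : 1 ≤ a) {ψ : ℝ → ℝ} (h : Adm a ψ) : Adm a (ψ ∘ phi0 a) := by
  obtain ⟨ψ', h⟩ := h
  have vmono : ∀ y ∈ II, ∀ z ∈ II, y ≤ z →
      (2:ℝ) ^ a * (phi0 a y) ^ a ≤ 2 ^ a * (phi0 a z) ^ a := by
    intro y hy z hz hyz
    exact mul_le_mul_of_nonneg_left (Real.rpow_le_rpow (phi0_mem ha hy).1.le
      (phi0_mono ha hy hz hyz) (by linarith)) (by positivity)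
  have vpos : ∀ y ∈ II, 0 < (2:ℝ) ^ a * (phi0 a y) ^ a := by
    intro y hy
    have := (phi0_mem ha hy).1
    positivity
  refine ⟨_, h.comp (φ' := dphi0 a) (fun y hy => phi0_memI ha hy)
    (fun y hy z hz => phi0_mono ha hy hz)
    (fun y hy => phi0_hasDerivAt ha hy) ?_ ?_ ?_⟩
  · intro y hy
    have := vpos y hy
    unfold dphi0
    have : 0 < 1 + (1 + a) * (2 ^ a * (phi0 a y) ^ a) := by nlinarith
    positivity
  · intro y hy z hz hyz
    unfold dphi0
    have := vpos y hy
    have h2 := vmono y hy z hz hyz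
    apply inv_anti₀
    · nlinarith
    · nlinarith
  · intro y hy z hz hyz
    have e : ∀ y ∈ II, y / phi0 a y = 1 + 2 ^ a * (phi0 a y) ^ a := by
      intro y hy
      have h0 := (phi0_mem ha hy).1
      rw [div_eq_iff h0.ne']
      nth_rewrite 1 [← lsvL_phi0 ha hy]
      unfold lsvL
      ring
    rw [e y hy, e z hz]
    exact phi0_aux ha (vpos y hy).le (vmono y hy z hz hyz)

lemma Ad.strictMono {a : ℝ} {ψ ψ' : ℝ → ℝ} (h : Ad a ψ ψ') : StrictMonoOn ψ II := by
  apply strictMonoOn_of_deriv_pos (convex_Ioo 0 1)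
  · intro y hy
    exact (h.hd y hy).continuousAt.continuousWithinAt
  · intro y hy
    rw [interior_Ioo] at hy
    rw [(h.hd y hy).deriv]
    exact h.pos y hy

lemma Ad.volume_image {a : ℝ} {ψ ψ' : ℝ → ℝ} (h : Ad a ψ ψ') {E : Set ℝ} (hE : MeasurableSet E)
    (hEI : E ⊆ II) : volume (ψ '' E) = ∫⁻ y in E, ENNReal.ofReal (ψ' y) := by
  rw [lintegral_deriv_eq_volume_image_of_monotoneOn hE
    (fun x hx => (h.hd x (hEI hx)).hasDerivWithinAt) (h.strictMono.monotoneOn.mono hEI)]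

lemma Adm.injOn {a : ℝ} {ψ : ℝ → ℝ} (h : Adm a ψ) : InjOn ψ II := by
  obtain ⟨ψ', h⟩ := h
  exact h.strictMono.injOn

lemma Adm.measurableSet_image {a : ℝ} {ψ : ℝ → ℝ} (h : Adm a ψ) {E : Set ℝ}
    (hE : MeasurableSet E) (hEI : E ⊆ II) : MeasurableSet (ψ '' E) := by
  refine hE.image_of_continuousOn_injOn ?_ (h.injOn.mono hEI)
  obtain ⟨ψ', h⟩ := h
  intro y hy
  exact (h.hd y (hEI hy)).continuousAt.continuousWithinAt

/-- The distortion constant. -/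
def KK (a : ℝ) : ENNReal := ENNReal.ofReal (2 ^ (1 + a))

lemma KK_ne_top (a : ℝ) : KK a ≠ ⊤ := ENNReal.ofReal_ne_top

lemma KK_ne_zero (a : ℝ) : KK a ≠ 0 := by
  unfold KK
  simp only [ne_eq, ENNReal.ofReal_eq_zero, not_le]
  positivity

lemma one_le_KK {a : ℝ} (ha : 1 ≤ a) : 1 ≤ KK a := by
  unfold KK
  rw [ENNReal.one_le_ofReal]
  exact Real.one_le_rpow (by norm_num) (by linarith)

lemma Adm.distort {a : ℝ} (ha : 1 ≤ a) {ψ : ℝ → ℝ} (h : Adm a ψ) :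
    ∃ c : ENNReal, c ≠ ⊤ ∧ ∀ E, MeasurableSet E → E ⊆ Ico (1 / 2 : ℝ) 1 →
      c * volume E ≤ volume (ψ '' E) ∧ volume (ψ '' E) ≤ KK a * c * volume E := by
  obtain ⟨ψ', h⟩ := h
  have hhalf : (1 / 2 : ℝ) ∈ II := by constructor <;> norm_num
  have hsub : Ico (1 / 2 : ℝ) 1 ⊆ II := fun y hy => ⟨by linarith [hy.1], hy.2⟩
  have kpos : (0:ℝ) < 2 ^ (1 + a) := by positivity
  refine ⟨ENNReal.ofReal (ψ' (1 / 2) / 2 ^ (1 + a)), ENNReal.ofReal_ne_top, fun E hE hEY => ?_⟩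
  have hEI := hEY.trans hsub
  rw [h.volume_image hE hEI]
  constructor
  · rw [← setLIntegral_const]
    refine setLIntegral_mono' hE fun y hy => ENNReal.ofReal_le_ofReal ?_
    have h1 := h.mono _ hhalf _ (hEI hy) (hEY hy).1
    rw [Real.div_rpow zero_le_one (by norm_num), Real.one_rpow] at h1
    have h2 : y ^ (1 + a) ≤ 1 := Real.rpow_le_one (hEI hy).1.le (hEI hy).2.le (by linarith)
    have h3 := h.pos y (hEI hy)
    calc ψ' (1 / 2) / 2 ^ (1 + a) = 1 / 2 ^ (1 + a) * ψ' (1 / 2) := by ring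
      _ ≤ y ^ (1 + a) * ψ' y := h1
      _ ≤ ψ' y := by nlinarith
  · rw [KK, ← ENNReal.ofReal_mul kpos.le, ← setLIntegral_const]
    refine setLIntegral_mono' hE fun y hy => ENNReal.ofReal_le_ofReal ?_
    rw [mul_div_cancel₀ _ kpos.ne']
    exact h.anti _ hhalf _ (hEI hy) (hEY hy).1

/-- Bounded distortion on the whole interval. -/
def Bd (a : ℝ) (χ : ℝ → ℝ) : Prop :=
  ∃ c : ENNReal, ∀ E, MeasurableSet E → E ⊆ II →
      c * volume E ≤ volume (χ '' E) ∧ volume (χ '' E) ≤ KK a * c * volume E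

lemma vol_II : volume II = 1 := by simp [II]

lemma Bd.upper {a : ℝ} {χ : ℝ → ℝ} (h : Bd a χ) {E : Set ℝ} (hE : MeasurableSet E)
    (hEI : E ⊆ II) : volume (χ '' E) ≤ KK a * volume E * volume (χ '' II) := by
  obtain ⟨c, h⟩ := h
  have h1 := (h II measurableSet_Ioo subset_rfl).1
  rw [vol_II, mul_one] at h1
  calc volume (χ '' E) ≤ KK a * c * volume E := (h E hE hEI).2
    _ ≤ KK a * volume (χ '' II) * volume E := by gcongr
    _ = _ := by ring

lemma Bd.lower {a : ℝ} {χ : ℝ → ℝ} (h : Bd a χ) {E : Set ℝ} (hE : MeasurableSet E)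
    (hEI : E ⊆ II) : volume (χ '' II) * volume E ≤ KK a * volume (χ '' E) := by
  obtain ⟨c, h⟩ := h
  have h1 := (h II measurableSet_Ioo subset_rfl).2
  rw [vol_II, mul_one] at h1
  calc volume (χ '' II) * volume E ≤ (KK a * c) * volume E := by gcongr
    _ = KK a * (c * volume E) := by ring
    _ ≤ _ := by gcongr; exact (h E hE hEI).1

lemma Bd.id {a : ℝ} (ha : 1 ≤ a) : Bd a id := by
  refine ⟨1, fun E _ _ => ?_⟩
  simp only [image_id, one_mul, mul_one, le_refl, true_and]
  exact le_mul_of_one_le_left zero_le (one_le_KK ha)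

lemma vol_phi1 (E : Set ℝ) : volume (phi1 '' E) = ENNReal.ofReal (1 / 2) * volume E := by
  have : phi1 '' E = (fun x => 1 / 2 + x) '' ((fun x => (1 / 2 : ℝ) • x) '' E) := by
    rw [image_image]
    apply image_congr
    intro x _
    simp only [phi1, smul_eq_mul]; ring
  rw [this, image_add_left, measure_preimage_add]
  have h := Measure.addHaar_smul (volume : Measure ℝ) (1 / 2 : ℝ) E
  rw [← image_smul] at h
  rw [h]
  norm_num

lemma Adm.bd_comp1 {a : ℝ} (ha : 1 ≤ a) {ψ : ℝ → ℝ} (h : Adm a ψ) : Bd a (ψ ∘ phi1) := by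
  obtain ⟨c, _, h⟩ := h.distort ha
  have hphi : Adm a phi1 := by simpa using (Adm.id ha).comp1 ha
  refine ⟨c * ENNReal.ofReal (1 / 2), fun E hE hEI => ?_⟩
  have := h (phi1 '' E) (hphi.measurableSet_image hE hEI) (by
    rintro _ ⟨y, hy, rfl⟩
    exact ⟨(phi1_gt (hEI hy)).le, (phi1_memI (hEI hy)).2⟩)
  rw [vol_phi1] at this
  rw [image_comp]
  refine ⟨?_, ?_⟩
  · rw [mul_assoc]; exact this.1
  · calc _ ≤ _ := this.2
      _ = _ := by ring

/-- Inverse branches of the jump transformation. -/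
def br (a : ℝ) (n : ℕ) : ℝ → ℝ := (phi0 a)^[n] ∘ phi1

lemma Adm.comp0n {a : ℝ} (ha : 1 ≤ a) {ψ : ℝ → ℝ} (h : Adm a ψ) (n : ℕ) :
    Adm a (ψ ∘ (phi0 a)^[n]) := by
  induction n with
  | zero => simpa using h
  | succ n ih =>
    rw [Function.iterate_succ, ← Function.comp_assoc]
    exact ih.comp0 ha

lemma Adm.comp_br {a : ℝ} (ha : 1 ≤ a) {ψ : ℝ → ℝ} (h : Adm a ψ) (n : ℕ) :
    Adm a (ψ ∘ br a n) := by
  unfold br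
  rw [← Function.comp_assoc]
  exact (h.comp0n ha n).comp1 ha

lemma Adm.bd_comp_br {a : ℝ} (ha : 1 ≤ a) {ψ : ℝ → ℝ} (h : Adm a ψ) (n : ℕ) :
    Bd a (ψ ∘ br a n) := by
  unfold br
  rw [← Function.comp_assoc]
  exact (h.comp0n ha n).bd_comp1 ha

lemma phi0_iter_memI {a y : ℝ} (ha : 1 ≤ a) (hy : y ∈ II) (n : ℕ) : (phi0 a)^[n] y ∈ II := by
  induction n with
  | zero => exact hy
  | succ n ih => rw [Function.iterate_succ_apply']; exact phi0_memI ha ih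

lemma phi0_iter_lip {a y z : ℝ} (ha : 1 ≤ a) (hy : y ∈ II) (hz : z ∈ II) (n : ℕ) :
    |(phi0 a)^[n] y - (phi0 a)^[n] z| ≤ |y - z| := by
  induction n with
  | zero => exact le_rfl
  | succ n ih =>
    rw [Function.iterate_succ_apply', Function.iterate_succ_apply']
    exact (phi0_lip ha (phi0_iter_memI ha hy n) (phi0_iter_memI ha hz n)).trans ih

lemma br_memI {a y : ℝ} (ha : 1 ≤ a) (hy : y ∈ II) (n : ℕ) : br a n y ∈ II :=
  phi0_iter_memI ha (phi1_memI hy) n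

lemma br_lip {a y z : ℝ} (ha : 1 ≤ a) (hy : y ∈ II) (hz : z ∈ II) (n : ℕ) :
    |br a n y - br a n z| ≤ 1 / 2 * |y - z| := by
  refine (phi0_iter_lip ha (phi1_memI hy) (phi1_memI hz) n).trans (le_of_eq ?_)
  have : phi1 y - phi1 z = 1 / 2 * (y - z) := by unfold phi1; ring
  rw [this, abs_mul]
  norm_num

/-! Dynamics -/

lemma lsv_zero {a : ℝ} : lsv a 0 = 0 := by
  rw [lsv_left (by norm_num), lsvL_zero]

lemma lsv_mem {a x : ℝ} (ha : 1 ≤ a) (hx : x ∈ Ico (0:ℝ) 1) : lsv a x ∈ Ico (0:ℝ) 1 := by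
  by_cases h : x < 1 / 2
  · rw [lsv_left h]
    rcases hx.1.eq_or_lt with h0 | h0
    · rw [← h0, lsvL_zero]; constructor <;> norm_num
    · have := lsvL_mem ha ⟨h0, h⟩
      exact ⟨this.1.le, this.2⟩
  · rw [lsv_right (not_lt.mp h)]
    constructor <;> linarith [hx.2]

lemma lsv_iter_mem {a x : ℝ} (ha : 1 ≤ a) (hx : x ∈ Ico (0:ℝ) 1) (n : ℕ) :
    (lsv a)^[n] x ∈ Ico (0:ℝ) 1 := by
  induction n with
  | zero => exact hx
  | succ n ih => rw [Function.iterate_succ_apply']; exact lsv_mem ha ih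

lemma lsv_iter_zero {a : ℝ} (n : ℕ) : (lsv a)^[n] 0 = 0 := by
  induction n with
  | zero => rfl
  | succ n ih => rw [Function.iterate_succ_apply', ih, lsv_zero]

lemma lsv_phi0 {a y : ℝ} (ha : 1 ≤ a) (hy : y ∈ II) : lsv a (phi0 a y) = y := by
  rw [lsv_left (phi0_mem ha hy).2, lsvL_phi0 ha hy]

lemma lsv_phi1 {a y : ℝ} (hy : y ∈ II) : lsv a (phi1 y) = y := by
  rw [lsv_right (phi1_gt hy).le]; unfold phi1; ring

lemma lsvL_step {a y : ℝ} (ha : 1 ≤ a) (hy : y ∈ Ioo (0:ℝ) (1 / 2)) :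
    (lsvL a y) ^ (-a) + 1 ≤ y ^ (-a) := by
  have h0 := hy.1
  set v := (2:ℝ) ^ a * y ^ a with hv
  have v0 : 0 < v := by positivity
  have v1 : v ≤ 1 := by
    rw [hv, ← Real.mul_rpow (by norm_num) h0.le]
    exact Real.rpow_le_one (by linarith) (by linarith [hy.2]) (by linarith)
  have e : (lsvL a y) ^ (-a) = y ^ (-a) * (1 + v) ^ (-a) := by
    unfold lsvL
    rw [← hv, Real.mul_rpow h0.le (by linarith)]
  have h1 : (1 + v) ^ (-a) ≤ (1 + v) ^ (-1 : ℝ) :=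
    Real.rpow_le_rpow_of_exponent_le (by linarith) (by linarith)
  have h2 : (1 + v) ^ (-1 : ℝ) ≤ 1 - v / 2 := by
    rw [Real.rpow_neg_one, inv_le_iff_one_le_mul₀ (by linarith)]
    nlinarith
  have h3 : y ^ (-a) * v = 2 ^ a := by
    rw [hv, Real.rpow_neg h0.le]
    field_simp
  have h4 : (2:ℝ) ≤ 2 ^ a := by
    calc (2:ℝ) = 2 ^ (1:ℝ) := by simp
      _ ≤ 2 ^ a := Real.rpow_le_rpow_of_exponent_le (by norm_num) ha
  have h5 : 0 < y ^ (-a) := by positivity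
  rw [e]
  nlinarith [mul_le_mul_of_nonneg_left (h1.trans h2) h5.le]

lemma exit_bound {a : ℝ} (ha : 1 ≤ a) (n : ℕ) : ∀ x ∈ II,
    (∀ i < n, (lsv a)^[i] x < 1 / 2) → 0 < (lsv a)^[n] x ∧ ((lsv a)^[n] x) ^ (-a) + n ≤ x ^ (-a) := by
  induction n with
  | zero => intro x hx _; simpa using hx.1
  | succ n ih =>
    intro x hx h
    obtain ⟨h1, h2⟩ := ih x hx (fun i hi => h i (by omega))
    have h3 := h n (by omega)
    rw [Function.iterate_succ_apply', lsv_left h3]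
    have h4 := lsvL_step ha ⟨h1, h3⟩
    refine ⟨(lsvL_mem ha ⟨h1, h3⟩).1, ?_⟩
    push_cast
    linarith

lemma exit_le {a : ℝ} (ha : 1 ≤ a) {n : ℕ} {x : ℝ} (hx : x ∈ II)
    (h : ∀ i < n, (lsv a)^[i] x < 1 / 2) : (n:ℝ) ≤ x ^ (-a) := by
  obtain ⟨h1, h2⟩ := exit_bound ha n x hx h
  have : 0 < ((lsv a)^[n] x) ^ (-a) := by positivity
  linarith

/-- Time to enter `[1/2,1)`. -/
def RR (a x : ℝ) : ℕ := sInf {n : ℕ | 1 / 2 ≤ (lsv a)^[n] x}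

/-- The jump transformation. -/
def GG (a x : ℝ) : ℝ := (lsv a)^[RR a x + 1] x

lemma RR_exists {a : ℝ} (ha : 1 ≤ a) {x : ℝ} (hx : x ∈ II) :
    {n : ℕ | 1 / 2 ≤ (lsv a)^[n] x}.Nonempty := by
  by_contra h
  rw [Set.not_nonempty_iff_eq_empty] at h
  obtain ⟨n, hn⟩ := exists_nat_gt (x ^ (-a))
  have := exit_le (n := n) ha hx (fun i _ => by
    by_contra h'
    have : i ∈ {n : ℕ | 1 / 2 ≤ (lsv a)^[n] x} := not_lt.mp h'
    rw [h] at this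
    exact this)
  linarith

lemma RR_spec {a : ℝ} (ha : 1 ≤ a) {x : ℝ} (hx : x ∈ II) : 1 / 2 ≤ (lsv a)^[RR a x] x :=
  Nat.sInf_mem (RR_exists ha hx)

lemma RR_min {a x : ℝ} {i : ℕ} (hi : i < RR a x) : (lsv a)^[i] x < 1 / 2 := by
  by_contra h
  exact Nat.notMem_of_lt_sInf hi (not_lt.mp h)

lemma RR_eq {a x : ℝ} {n : ℕ} (h : 1 / 2 ≤ (lsv a)^[n] x) (h' : ∀ i < n, (lsv a)^[i] x < 1 / 2) :
    RR a x = n := by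
  apply le_antisymm (Nat.sInf_le h)
  by_contra hlt
  have := h' (RR a x) (not_le.mp hlt)
  have h2 : 1 / 2 ≤ (lsv a)^[RR a x] x := Nat.sInf_mem (s := {n : ℕ | 1 / 2 ≤ (lsv a)^[n] x}) ⟨n, h⟩
  linarith

lemma RR_le {a : ℝ} (ha : 1 ≤ a) {x : ℝ} (hx : x ∈ II) : (RR a x : ℝ) ≤ x ^ (-a) :=
  exit_le ha hx fun _ hi => RR_min hi

lemma RR_zero {a : ℝ} : RR a 0 = 0 := by
  have : {n : ℕ | 1 / 2 ≤ (lsv a)^[n] 0} = ∅ := by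
    ext n
    simp only [lsv_iter_zero, mem_ofPred_eq, mem_empty_iff_false, iff_false]
    norm_num
  simp only [RR, this, Nat.sInf_empty]

lemma GG_zero {a : ℝ} : GG a 0 = 0 := lsv_iter_zero _

lemma GG_mem {a x : ℝ} (ha : 1 ≤ a) (hx : x ∈ Ico (0:ℝ) 1) : GG a x ∈ Ico (0:ℝ) 1 :=
  lsv_iter_mem ha hx _

lemma GG_eq {a : ℝ} (ha : 1 ≤ a) {x : ℝ} (hx : x ∈ II) :
    (lsv a)^[RR a x] x = phi1 (GG a x) := by
  unfold GG phi1
  rw [Function.iterate_succ_apply', lsv_right (RR_spec ha hx)]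
  ring

lemma eq_phi0_iter {a : ℝ} (ha : 1 ≤ a) (n : ℕ) : ∀ x ∈ II,
    (∀ i < n, (lsv a)^[i] x < 1 / 2) → x = (phi0 a)^[n] ((lsv a)^[n] x) := by
  induction n with
  | zero => intro x _ _; rfl
  | succ n ih =>
    intro x hx h
    have h0 : x < 1 / 2 := h 0 (by omega)
    have e0 : lsv a x = lsvL a x := lsv_left h0
    have h1 : lsv a x ∈ II := by rw [e0]; exact lsvL_mem ha ⟨hx.1, h0⟩
    have := ih (lsv a x) h1 (fun i hi => by
      rw [← Function.iterate_succ_apply]; exact h (i + 1) (by omega))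
    rw [Function.iterate_succ_apply', Function.iterate_succ_apply, ← this, e0,
      phi0_lsvL ha ⟨hx.1, h0⟩]

lemma lsv_iter_phi0 {a y : ℝ} (ha : 1 ≤ a) (hy : y ∈ II) (i n : ℕ) :
    (lsv a)^[i] ((phi0 a)^[n + i] y) = (phi0 a)^[n] y := by
  induction i with
  | zero => rfl
  | succ i ih =>
    rw [← add_assoc, Function.iterate_succ_apply' (phi0 a), Function.iterate_succ_apply (lsv a),
      lsv_phi0 ha (phi0_iter_memI ha hy _), ih]

lemma RR_br {a y : ℝ} (ha : 1 ≤ a) (hy : y ∈ II) (n : ℕ) : RR a (br a n y) = n := by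
  have hy1 := phi1_memI hy
  apply RR_eq
  · have := lsv_iter_phi0 ha hy1 n 0
    rw [zero_add] at this
    simp only [br, Function.comp]
    rw [this]
    exact (phi1_gt hy).le
  · intro i hi
    obtain ⟨k, rfl⟩ : ∃ k, n = (k + 1) + i := ⟨n - i - 1, by omega⟩
    simp only [br, Function.comp]
    rw [lsv_iter_phi0 ha hy1, Function.iterate_succ_apply']
    exact (phi0_mem ha (phi0_iter_memI ha hy1 k)).2

lemma GG_br {a y : ℝ} (ha : 1 ≤ a) (hy : y ∈ II) (n : ℕ) : GG a (br a n y) = y := by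
  have hy1 := phi1_memI hy
  unfold GG
  rw [RR_br ha hy, Function.iterate_succ_apply']
  have := lsv_iter_phi0 ha hy1 n 0
  rw [zero_add] at this
  simp only [br, Function.comp]
  rw [this]
  exact lsv_phi1 hy

lemma br_GG {a x : ℝ} (ha : 1 ≤ a) (hx : x ∈ II) : br a (RR a x) (GG a x) = x := by
  simp only [br, Function.comp]
  rw [← GG_eq ha hx]
  exact (eq_phi0_iter ha _ x hx fun _ hi => RR_min hi).symm

/-- Pull-back of `E` under the `k`-th iterate of the jump transformation. -/
def PG (a : ℝ) (k : ℕ) (E : Set ℝ) : Set ℝ := {x | x ∈ II ∧ (GG a)^[k] x ∈ E}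

lemma GG_iter_zero {a : ℝ} (n : ℕ) : (GG a)^[n] 0 = 0 := by
  induction n with
  | zero => rfl
  | succ n ih => rw [Function.iterate_succ_apply', ih, GG_zero]

lemma GG_iter_mem {a x : ℝ} (ha : 1 ≤ a) (hx : x ∈ Ico (0:ℝ) 1) (n : ℕ) :
    (GG a)^[n] x ∈ Ico (0:ℝ) 1 := by
  induction n with
  | zero => exact hx
  | succ n ih => rw [Function.iterate_succ_apply']; exact GG_mem ha ih

lemma II_sub_Ico {x : ℝ} (hx : x ∈ II) : x ∈ Ico (0:ℝ) 1 := ⟨hx.1.le, hx.2⟩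

lemma GG_iter_memI {a x : ℝ} (ha : 1 ≤ a) (hx : x ∈ II) (k n : ℕ)
    (h : (GG a)^[k + n] x ∈ II) : (GG a)^[n] x ∈ II := by
  have h1 := GG_iter_mem ha (II_sub_Ico hx) n
  rcases h1.1.eq_or_lt with h0 | h0
  · rw [Function.iterate_add_apply, ← h0, GG_iter_zero] at h
    exact absurd h.1 (lt_irrefl _)
  · exact ⟨h0, h1.2⟩

lemma PG_zero {a : ℝ} {E : Set ℝ} (hE : E ⊆ II) : PG a 0 E = E := by
  ext x
  exact ⟨fun h => h.2, fun h => ⟨hE h, h⟩⟩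

lemma PG_sub {a : ℝ} {k : ℕ} {E : Set ℝ} : PG a k E ⊆ II := fun _ h => h.1

lemma PG_succ {a : ℝ} (ha : 1 ≤ a) (k : ℕ) {E : Set ℝ} (hE : E ⊆ II) :
    PG a (k + 1) E = ⋃ n, br a n '' PG a k E := by
  ext x
  simp only [mem_iUnion]
  constructor
  · rintro ⟨hx, h⟩
    have h1 : GG a x ∈ II := GG_iter_memI ha hx k 1 (hE h)
    exact ⟨RR a x, GG a x, ⟨h1, h⟩, br_GG ha hx⟩
  · rintro ⟨n, y, ⟨hy, h⟩, rfl⟩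
    refine ⟨br_memI ha hy n, ?_⟩
    rw [Function.iterate_succ_apply, GG_br ha hy]
    exact h

lemma br_adm {a : ℝ} (ha : 1 ≤ a) (n : ℕ) : Adm a (br a n) := by
  simpa using (Adm.id ha).comp_br ha n

lemma PG_meas {a : ℝ} (ha : 1 ≤ a) (k : ℕ) {E : Set ℝ} (hE : E ⊆ II) (hm : MeasurableSet E) :
    MeasurableSet (PG a k E) := by
  induction k with
  | zero => rw [PG_zero hE]; exact hm
  | succ k ih =>
    rw [PG_succ ha k hE]
    exact MeasurableSet.iUnion fun n => (br_adm ha n).measurableSet_image ih PG_sub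

lemma br_disj {a : ℝ} (ha : 1 ≤ a) {χ : ℝ → ℝ} (h : Adm a χ) {E : Set ℝ} (hE : E ⊆ II) :
    Pairwise (Function.onFun Disjoint fun n => (χ ∘ br a n) '' E) := by
  intro n m hnm
  rw [Function.onFun, Set.disjoint_left]
  rintro _ ⟨y, hy, rfl⟩ ⟨z, hz, e⟩
  have := h.injOn (br_memI ha (hE hz) m) (br_memI ha (hE hy) n) e
  apply hnm
  rw [← RR_br ha (hE hy) n, ← this, RR_br ha (hE hz) m]

lemma vol_PG_succ {a : ℝ} (ha : 1 ≤ a) (k : ℕ) {χ : ℝ → ℝ} (h : Adm a χ) {E : Set ℝ}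
    (hE : E ⊆ II) (hm : MeasurableSet E) :
    volume (χ '' PG a (k + 1) E) = ∑' n, volume ((χ ∘ br a n) '' PG a k E) := by
  rw [PG_succ ha k hE, image_iUnion, ← measure_iUnion (br_disj ha h PG_sub)]
  · congr 1
    apply iUnion_congr
    intro n
    rw [image_comp]
  · intro n
    exact (h.comp_br ha n).measurableSet_image (PG_meas ha k hE hm) PG_sub

lemma II_null {a : ℝ} (ha : 1 ≤ a) : (II \ PG a 1 II).Countable := by
  have : II \ PG a 1 II ⊆ range (fun n : ℕ => (phi0 a)^[n] (1 / 2)) := by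
    rintro x ⟨hx, h⟩
    have h1 := GG_mem ha (II_sub_Ico hx)
    have h2 : GG a x = 0 := by
      by_contra h0
      exact h ⟨hx, lt_of_le_of_ne h1.1 (Ne.symm h0), h1.2⟩
    refine ⟨RR a x, ?_⟩
    have := br_GG ha hx
    rw [h2] at this
    simpa [br, phi1] using this
  exact (countable_range _).mono this

lemma vol_II_br {a : ℝ} (ha : 1 ≤ a) (χ : ℝ → ℝ) (B : Set ℝ) :
    volume (χ '' II ∩ B) ≤ ∑' n, volume ((χ ∘ br a n) '' II ∩ B) := by
  have h1 : χ '' II ∩ B ⊆ χ '' (II \ PG a 1 II) ∪ ⋃ n, ((χ ∘ br a n) '' II ∩ B) := by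
    rintro _ ⟨⟨x, hx, rfl⟩, hB⟩
    by_cases hp : x ∈ PG a 1 II
    · right
      rw [PG_succ ha 0 subset_rfl] at hp
      obtain ⟨n, y, hy, rfl⟩ := mem_iUnion.mp hp
      exact mem_iUnion.mpr ⟨n, ⟨y, PG_sub hy, rfl⟩, hB⟩
    · left
      exact ⟨x, ⟨hx, hp⟩, rfl⟩
  refine (measure_mono h1).trans ((measure_union_le _ _).trans ?_)
  rw [((II_null ha).image χ).measure_zero volume, zero_add]
  exact measure_iUnion_le _

lemma G_upper {a : ℝ} (ha : 1 ≤ a) {E : Set ℝ} (hE : E ⊆ II) (hm : MeasurableSet E) (k : ℕ) :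
    ∀ χ, Adm a χ → Bd a χ → volume (χ '' PG a k E) ≤ KK a * volume E * volume (χ '' II) := by
  induction k with
  | zero => intro χ _ h2; rw [PG_zero hE]; exact h2.upper hm hE
  | succ k ih =>
    intro χ h1 h2
    rw [vol_PG_succ ha k h1 hE hm]
    calc ∑' n, volume ((χ ∘ br a n) '' PG a k E)
        ≤ ∑' n, KK a * volume E * volume ((χ ∘ br a n) '' II) :=
          ENNReal.tsum_le_tsum fun n => ih _ (h1.comp_br ha n) (h1.bd_comp_br ha n)
      _ = KK a * volume E * ∑' n, volume ((χ ∘ br a n) '' II) := ENNReal.tsum_mul_left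
      _ ≤ KK a * volume E * volume (χ '' II) := by
        gcongr
        have := vol_PG_succ ha 0 h1 (E := II) subset_rfl measurableSet_Ioo
        rw [PG_zero subset_rfl] at this
        rw [← this]
        exact measure_mono (image_mono PG_sub)

lemma G_lower {a : ℝ} (ha : 1 ≤ a) {E : Set ℝ} (hE : E ⊆ II) (hm : MeasurableSet E) (k : ℕ) :
    ∀ χ, Adm a χ → Bd a χ → volume (χ '' II) * volume E ≤ KK a * volume (χ '' PG a k E) := by
  induction k with
  | zero => intro χ _ h2; rw [PG_zero hE]; exact h2.lower hm hE
  | succ k ih =>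
    intro χ h1 h2
    rw [vol_PG_succ ha k h1 hE hm]
    have h3 := vol_II_br ha χ univ
    simp only [inter_univ] at h3
    calc volume (χ '' II) * volume E
        ≤ (∑' n, volume ((χ ∘ br a n) '' II)) * volume E := by gcongr
      _ = ∑' n, volume ((χ ∘ br a n) '' II) * volume E := ENNReal.tsum_mul_right.symm
      _ ≤ ∑' n, KK a * volume ((χ ∘ br a n) '' PG a k E) :=
          ENNReal.tsum_le_tsum fun n => ih _ (h1.comp_br ha n) (h1.bd_comp_br ha n)
      _ = _ := ENNReal.tsum_mul_left

lemma G_cyl {a : ℝ} (ha : 1 ≤ a) {E : Set ℝ} (hE : E ⊆ II) (hm : MeasurableSet E)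
    {u v η : ℝ} (m : ℕ) : ∀ (χ : ℝ → ℝ) (l : ℝ), Adm a χ → Bd a χ →
      (∀ y ∈ II, ∀ z ∈ II, |χ y - χ z| ≤ l * |y - z|) → (1 / 2) ^ m * l ≤ η → 0 ≤ l →
      volume (χ '' II ∩ Ioo u v) * volume E
        ≤ KK a * volume (χ '' PG a m E ∩ Ioo (u - η) (v + η)) := by
  induction m with
  | zero =>
    intro χ l _ h2 h3 h4 hl
    rw [PG_zero hE]
    rw [pow_zero, one_mul] at h4
    by_cases hne : (χ '' II ∩ Ioo u v).Nonempty
    · obtain ⟨_, ⟨y, hy, rfl⟩, hyB⟩ := hne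
      have : χ '' E ∩ Ioo (u - η) (v + η) = χ '' E := by
        apply inter_eq_left.mpr
        rintro _ ⟨z, hz, rfl⟩
        have h5 := h3 y hy z (hE hz)
        have h6 : |y - z| ≤ 1 := by
          rw [abs_le]
          constructor <;> linarith [hy.1, hy.2, (hE hz).1, (hE hz).2]
        have h7 : |χ y - χ z| ≤ η := h5.trans (by nlinarith)
        rw [abs_le] at h7
        constructor <;> linarith [hyB.1, hyB.2]
      rw [this]
      refine le_trans ?_ (h2.lower hm hE)
      gcongr
      exact inter_subset_left
    · rw [Set.not_nonempty_iff_eq_empty] at hne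
      rw [hne]; simp
  | succ m ih =>
    intro χ l h1 h2 h3 h4 hl
    have e : χ '' PG a (m + 1) E ∩ Ioo (u - η) (v + η)
        = ⋃ n, ((χ ∘ br a n) '' PG a m E ∩ Ioo (u - η) (v + η)) := by
      rw [PG_succ ha m hE, image_iUnion, iUnion_inter]
      apply iUnion_congr
      intro n
      rw [image_comp]
    rw [e, measure_iUnion]
    · calc volume (χ '' II ∩ Ioo u v) * volume E
          ≤ (∑' n, volume ((χ ∘ br a n) '' II ∩ Ioo u v)) * volume E := by
            gcongr
            exact vol_II_br ha χ _
        _ = ∑' n, volume ((χ ∘ br a n) '' II ∩ Ioo u v) * volume E := ENNReal.tsum_mul_right.symm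
        _ ≤ ∑' n, KK a * volume ((χ ∘ br a n) '' PG a m E ∩ Ioo (u - η) (v + η)) := by
            refine ENNReal.tsum_le_tsum fun n => ih _ (l / 2) (h1.comp_br ha n)
              (h1.bd_comp_br ha n) ?_ ?_ (by linarith)
            · intro y hy z hz
              refine (h3 _ (br_memI ha hy n) _ (br_memI ha hz n)).trans ?_
              have := br_lip ha hy hz n
              calc l * |br a n y - br a n z| ≤ l * (1 / 2 * |y - z|) := by gcongr
                _ = _ := by ring
            · rw [pow_succ] at h4
              linarith
        _ = _ := ENNReal.tsum_mul_left
    · intro n n' hn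
      exact (br_disj ha h1 PG_sub hn).mono inter_subset_left inter_subset_left
    · intro n
      exact ((h1.comp_br ha n).measurableSet_image (PG_meas ha m hE hm) PG_sub).inter
        measurableSet_Ioo

lemma PG_upper {a : ℝ} (ha : 1 ≤ a) {E : Set ℝ} (hE : E ⊆ II) (hm : MeasurableSet E) (k : ℕ) :
    volume (PG a k E) ≤ KK a * volume E := by
  have := G_upper ha hE hm k id (Adm.id ha) (Bd.id ha)
  simpa [-Set.mem_Ioo] using this

lemma PG_lower {a : ℝ} (ha : 1 ≤ a) {E : Set ℝ} (hE : E ⊆ II) (hm : MeasurableSet E) (k : ℕ) :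
    volume E ≤ KK a * volume (PG a k E) := by
  have := G_lower ha hE hm k id (Adm.id ha) (Bd.id ha)
  simpa [-Set.mem_Ioo] using this

lemma PG_cyl {a : ℝ} (ha : 1 ≤ a) {E : Set ℝ} (hE : E ⊆ II) (hm : MeasurableSet E)
    {u v η : ℝ} (m : ℕ) (huv : Ioo u v ⊆ II) (hη : (1 / 2) ^ m ≤ η) :
    volume (Ioo u v) * volume E ≤ KK a * volume (PG a m E ∩ Ioo (u - η) (v + η)) := by
  have := G_cyl ha hE hm (u := u) (v := v) (η := η) m id 1 (Adm.id ha) (Bd.id ha)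
    (fun y _ z _ => by simp) (by simpa using hη) zero_le_one
  rw [image_id, image_id, inter_eq_right.mpr huv] at this
  exact this

/-- Points whose orbit under the jump map avoids `B` during `[2, L+2)`. -/
def Avoid (a : ℝ) (L : ℕ) (B : Set ℝ) : Set ℝ := {x | x ∈ II ∧ ∀ k < L, (GG a)^[k + 2] x ∉ B}

lemma Avoid_meas {a : ℝ} (ha : 1 ≤ a) (L : ℕ) {B : Set ℝ} (hB : B ⊆ II) (hm : MeasurableSet B) :
    MeasurableSet (Avoid a L B) := by
  have : Avoid a L B = II \ ⋃ k : Fin L, PG a (k + 2) B := by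
    ext x
    simp only [Avoid, PG, mem_ofPred_eq, Set.mem_sdiff, mem_iUnion, not_exists, not_and]
    constructor
    · rintro ⟨h1, h2⟩
      exact ⟨h1, fun k _ => h2 k k.2⟩
    · rintro ⟨h1, h2⟩
      exact ⟨h1, fun k hk => h2 ⟨k, hk⟩ h1⟩
  rw [this]
  exact measurableSet_Ioo.diff (MeasurableSet.iUnion fun k => PG_meas ha _ hB hm)

lemma Avoid_bound {a : ℝ} (ha : 1 ≤ a) {u v η : ℝ} (m L : ℕ) (huv : Ioo u v ⊆ II)
    (hB : Ioo (u - η) (v + η) ⊆ II) (hη : (1 / 2) ^ m ≤ η) :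
    (L : ENNReal) * (volume (Ioo u v) * volume (Avoid a ((m + 2) * L) (Ioo (u - η) (v + η))))
      ≤ KK a * KK a := by
  set B := Ioo (u - η) (v + η) with hBdef
  set A := Avoid a ((m + 2) * L) B with hA
  have hAI : A ⊆ II := fun _ h => h.1
  have hAm : MeasurableSet A := Avoid_meas ha _ hB measurableSet_Ioo
  set D := PG a m A ∩ B with hD
  have hDI : D ⊆ II := inter_subset_right.trans hB
  have hDm : MeasurableSet D := (PG_meas ha m hAI hAm).inter measurableSet_Ioo
  set W : Fin L → Set ℝ := fun i => PG a ((m + 2) * i + 2) D with hW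
  have hWm : ∀ i, MeasurableSet (W i) := fun i => PG_meas ha _ hDI hDm
  have key : ∀ i j : Fin L, i < j → Disjoint (W i) (W j) := by
    intro i j hij
    rw [Set.disjoint_left]
    rintro x ⟨_, hx⟩ ⟨_, hx'⟩
    have h1 := hx.1.2.2
    obtain ⟨d, hd⟩ : ∃ d : ℕ, (j : ℕ) = i + 1 + d := ⟨j - i - 1, by have : (i:ℕ) < j := hij; omega⟩
    have hdL : d < L := by have := j.2; omega
    have h2 := h1 ((m + 2) * d) (by
      exact Nat.mul_lt_mul_of_pos_left hdL (by omega))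
    rw [← Function.iterate_add_apply, ← Function.iterate_add_apply] at h2
    apply h2
    have h3 := hx'.2
    convert! h3 using 2
    rw [hd]
    ring
  have hdisj : Pairwise (Function.onFun Disjoint W) := by
    intro i j hij
    rcases lt_or_gt_of_ne hij with h | h
    · exact key i j h
    · exact (key j i h).symm
  have hsum : ∑' i, volume (W i) ≤ 1 := by
    rw [← measure_iUnion hdisj hWm, ← vol_II]
    exact measure_mono (iUnion_subset fun i => PG_sub)
  have h1 : volume (Ioo u v) * volume A ≤ KK a * volume D := PG_cyl ha hAI hAm m huv hη
  calc (L : ENNReal) * (volume (Ioo u v) * volume A) 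
      ≤ L * (KK a * volume D) := by gcongr
    _ = KK a * ∑' _ : Fin L, volume D := by simp; ring
    _ ≤ KK a * ∑' i : Fin L, KK a * volume (W i) := by
        gcongr with i
        exact PG_lower ha hDI hDm _
    _ = KK a * (KK a * ∑' i : Fin L, volume (W i)) := by rw [ENNReal.tsum_mul_left]
    _ ≤ KK a * (KK a * 1) := by gcongr
    _ = _ := by ring

/-- Pull-back under iterates of the map itself. -/
def PF (a : ℝ) (k : ℕ) (E : Set ℝ) : Set ℝ := {x | x ∈ II ∧ (lsv a)^[k] x ∈ E}

lemma PF_zero {a : ℝ} {E : Set ℝ} (hE : E ⊆ II) : PF a 0 E = E := by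
  ext x
  exact ⟨fun h => h.2, fun h => ⟨hE h, h⟩⟩

lemma PF_sub {a : ℝ} {k : ℕ} {E : Set ℝ} : PF a k E ⊆ II := fun _ h => h.1

lemma PF_succ {a : ℝ} (ha : 1 ≤ a) (k : ℕ) {E : Set ℝ} (hE : E ⊆ II) :
    PF a (k + 1) E = phi0 a '' PF a k E ∪ phi1 '' PF a k E := by
  ext x
  constructor
  · rintro ⟨hx, h⟩
    rw [Function.iterate_succ_apply] at h
    have h1 := lsv_mem ha (II_sub_Ico hx)
    have h2 : lsv a x ∈ II := by
      rcases h1.1.eq_or_lt with h0 | h0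
      · rw [← h0, lsv_iter_zero] at h
        exact absurd (hE h).1 (lt_irrefl _)
      · exact ⟨h0, h1.2⟩
    by_cases hlt : x < 1 / 2
    · left
      refine ⟨lsv a x, ⟨h2, h⟩, ?_⟩
      rw [lsv_left hlt, phi0_lsvL ha ⟨hx.1, hlt⟩]
    · right
      refine ⟨lsv a x, ⟨h2, h⟩, ?_⟩
      rw [lsv_right (not_lt.mp hlt)]
      unfold phi1; ring
  · rintro (⟨y, ⟨hy, h⟩, rfl⟩ | ⟨y, ⟨hy, h⟩, rfl⟩)
    · refine ⟨phi0_memI ha hy, ?_⟩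
      rw [Function.iterate_succ_apply, lsv_phi0 ha hy]
      exact h
    · refine ⟨phi1_memI hy, ?_⟩
      rw [Function.iterate_succ_apply, lsv_phi1 hy]
      exact h

lemma PF_meas {a : ℝ} (ha : 1 ≤ a) (k : ℕ) {E : Set ℝ} (hE : E ⊆ II) (hm : MeasurableSet E) :
    MeasurableSet (PF a k E) := by
  have e0 : Adm a (phi0 a) := by simpa using (Adm.id ha).comp0 ha
  have e1 : Adm a phi1 := by simpa using (Adm.id ha).comp1 ha
  induction k with
  | zero => rw [PF_zero hE]; exact hm
  | succ k ih =>
    rw [PF_succ ha k hE]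
    exact (e0.measurableSet_image ih PF_sub).union (e1.measurableSet_image ih PF_sub)

lemma vol_PF_succ {a : ℝ} (ha : 1 ≤ a) (k : ℕ) {χ : ℝ → ℝ} (h : Adm a χ) {E : Set ℝ}
    (hE : E ⊆ II) (hm : MeasurableSet E) :
    volume (χ '' PF a (k + 1) E)
      = volume ((χ ∘ phi0 a) '' PF a k E) + volume ((χ ∘ phi1) '' PF a k E) := by
  rw [PF_succ ha k hE, image_union, measure_union, image_comp, image_comp]
  · rw [Set.disjoint_left]
    rintro _ ⟨_, ⟨y, hy, rfl⟩, rfl⟩ ⟨_, ⟨z, hz, rfl⟩, e⟩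
    have := h.injOn (phi1_memI (PF_sub hz)) (phi0_memI ha (PF_sub hy)) e
    have h1 := phi1_gt (PF_sub hz)
    have h2 := (phi0_mem ha (PF_sub hy)).2
    linarith
  · rw [← image_comp]
    exact (h.comp1 ha).measurableSet_image (PF_meas ha k hE hm) PF_sub

lemma F_compare {a : ℝ} (ha : 1 ≤ a) {E E' : Set ℝ} (hE : E ⊆ Ico (1 / 2 : ℝ) 1)
    (hm : MeasurableSet E) (hE' : E' ⊆ Ico (1 / 2 : ℝ) 1) (hm' : MeasurableSet E') (k : ℕ) :
    ∀ χ, Adm a χ → volume (χ '' PF a k E) * volume E' ≤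
      KK a * volume E * volume (χ '' PF a k E') := by
  have hsub : Ico (1 / 2 : ℝ) 1 ⊆ II := fun y hy => ⟨by linarith [hy.1], hy.2⟩
  have hEI := hE.trans hsub
  have hEI' := hE'.trans hsub
  induction k with
  | zero =>
    intro χ h
    obtain ⟨c, -, hc⟩ := h.distort ha
    rw [PF_zero hEI, PF_zero hEI']
    calc volume (χ '' E) * volume E' ≤ (KK a * c * volume E) * volume E' := by
          gcongr; exact (hc E hm hE).2
      _ = KK a * volume E * (c * volume E') := by ring
      _ ≤ _ := by gcongr; exact (hc E' hm' hE').1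
  | succ k ih =>
    intro χ h
    rw [vol_PF_succ ha k h hEI hm, vol_PF_succ ha k h hEI' hm', add_mul, mul_add]
    exact add_le_add (ih _ (h.comp0 ha)) (ih _ (h.comp1 ha))

lemma lsvL_step_lower {a y : ℝ} (ha : 1 ≤ a) (hy : 0 < y) :
    y ^ (-a) - a * 2 ^ a ≤ (lsvL a y) ^ (-a) := by
  set v := (2:ℝ) ^ a * y ^ a with hv
  have v0 : 0 < v := by positivity
  have e : (lsvL a y) ^ (-a) = y ^ (-a) * (1 + v) ^ (-a) := by
    unfold lsvL
    rw [← hv, Real.mul_rpow hy.le (by linarith)]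
  have h2 : 1 - a * v ≤ (1 + v) ^ (-a) := by
    have h1 : -1 ≤ -(v / (1 + v)) := by
      have : v / (1 + v) ≤ 1 := by rw [div_le_one (by linarith)]; linarith
      linarith
    have := one_add_mul_self_le_rpow_one_add h1 ha
    have e2 : 1 + -(v / (1 + v)) = (1 + v)⁻¹ := by
      have : 1 + v ≠ 0 := by positivity
      field_simp; ring
    rw [e2, Real.inv_rpow (by linarith), ← Real.rpow_neg (by linarith)] at this
    have h3 : v / (1 + v) ≤ v := div_le_self v0.le (by linarith)
    nlinarith
  have h3 : y ^ (-a) * v = 2 ^ a := by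
    rw [hv, Real.rpow_neg hy.le]
    field_simp
  have h5 : 0 < y ^ (-a) := by positivity
  rw [e]
  nlinarith [mul_le_mul_of_nonneg_left h2 h5.le]

/-- Points below this threshold need at least `N` steps to leave `[0,1/2)`. -/
def dl (a : ℝ) (N : ℕ) : ℝ := (2 ^ a + a * 2 ^ a * N) ^ (-(1 / a))

lemma dl_pos {a : ℝ} (ha : 1 ≤ a) (N : ℕ) : 0 < dl a N := by
  unfold dl
  have : (0:ℝ) < 2 ^ a + a * 2 ^ a * N := by positivity
  positivity

lemma dl_le {a : ℝ} (ha : 1 ≤ a) (N : ℕ) : dl a N ≤ 1 / 2 := by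
  unfold dl
  have h : (2:ℝ) ^ a ≤ 2 ^ a + a * 2 ^ a * N := by
    have : (0:ℝ) ≤ a * 2 ^ a * N := by positivity
    linarith
  calc (2 ^ a + a * 2 ^ a * (N:ℝ)) ^ (-(1 / a)) ≤ ((2:ℝ) ^ a) ^ (-(1 / a)) :=
        Real.rpow_le_rpow_of_nonpos (by positivity) h (by
          have : 0 < 1 / a := by positivity
          linarith)
    _ = 1 / 2 := by
      rw [← Real.rpow_mul (by norm_num), mul_neg, mul_one_div_cancel (by positivity),
        Real.rpow_neg_one]
      norm_num

lemma stay {a : ℝ} (ha : 1 ≤ a) {N : ℕ} {y : ℝ} (hy : 0 < y) (hyd : y < dl a N) (i : ℕ)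
    (hi : i ≤ N) : 0 < (lsv a)^[i] y ∧ (lsv a)^[i] y < 1 / 2 := by
  have ypos : (2:ℝ) ^ a + a * 2 ^ a * N < y ^ (-a) := by
    have := Real.rpow_lt_rpow_of_neg hy hyd (z := -a) (by linarith)
    unfold dl at this
    rw [← Real.rpow_mul (by positivity), neg_mul_neg, one_div_mul_cancel (by positivity),
      Real.rpow_one] at this
    exact this
  have conv : ∀ z : ℝ, 0 < z → (2:ℝ) ^ a < z ^ (-a) → z < 1 / 2 := by
    intro z hz h
    by_contra hn
    have := Real.rpow_le_rpow_of_nonpos (by norm_num) (not_lt.mp hn) (z := -a) (by linarith)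
    rw [one_div, Real.inv_rpow (by norm_num), ← Real.rpow_neg (by norm_num), neg_neg] at this
    linarith
  have key : ∀ i ≤ N, 0 < (lsv a)^[i] y ∧ y ^ (-a) - a * 2 ^ a * i ≤ ((lsv a)^[i] y) ^ (-a) := by
    intro i
    induction i with
    | zero => intro _; simpa using hy
    | succ i ih =>
      intro hi
      obtain ⟨h1, h2⟩ := ih (by omega)
      have h3 : (i:ℝ) ≤ N := by exact_mod_cast (by omega : i ≤ N)
      have h4 : (lsv a)^[i] y < 1 / 2 := by
        apply conv _ h1
        have : a * 2 ^ a * (i:ℝ) ≤ a * 2 ^ a * N := by gcongr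
        linarith
      rw [Function.iterate_succ_apply', lsv_left h4]
      refine ⟨(lsvL_mem ha ⟨h1, h4⟩).1, ?_⟩
      have := lsvL_step_lower ha h1
      push_cast
      linarith
  obtain ⟨h1, h2⟩ := key i hi
  refine ⟨h1, conv _ h1 ?_⟩
  have h3 : (i:ℝ) ≤ N := by exact_mod_cast hi
  have : a * 2 ^ a * (i:ℝ) ≤ a * 2 ^ a * N := by gcongr
  linarith

lemma hit_low {a : ℝ} (ha : 1 ≤ a) (N : ℕ) {H : Set ℝ} (hH : H ⊆ Ico (1 / 2 : ℝ) 1)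
    (hm : MeasurableSet H) :
    volume {x | x ∈ II ∧ ∃ n < N, (lsv a)^[n] x ∈ H} * ENNReal.ofReal (dl a N / 2)
      ≤ KK a * volume H := by
  set E := Ioo (1 / 2 : ℝ) (1 / 2 + dl a N / 2) with hEdef
  have d0 := dl_pos ha N
  have d1 := dl_le ha N
  have hE : E ⊆ Ico (1 / 2 : ℝ) 1 := fun y hy => ⟨hy.1.le, by linarith [hy.2]⟩
  have hsub : Ico (1 / 2 : ℝ) 1 ⊆ II := fun y hy => ⟨by linarith [hy.1], hy.2⟩
  have hEm : MeasurableSet E := measurableSet_Ioo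
  have volE : volume E = ENNReal.ofReal (dl a N / 2) := by
    rw [hEdef, Real.volume_Ioo]; congr 1; ring
  have key : ∀ i j : Fin N, i < j → Disjoint (PF a i E) (PF a j E) := by
    intro i j hij
    rw [Set.disjoint_left]
    rintro x ⟨_, hx⟩ ⟨_, hx'⟩
    obtain ⟨d, hd⟩ : ∃ d : ℕ, (j : ℕ) = d + (i + 1) :=
      ⟨j - i - 1, by have : (i:ℕ) < j := hij; omega⟩
    rw [hd, Function.iterate_add_apply, Function.iterate_succ_apply'] at hx'
    set y := (lsv a)^[(i:ℕ)] x
    rw [lsv_right hx.1.le] at hx'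
    have := (stay ha (N := N) (y := 2 * y - 1) (by linarith [hx.1]) (by linarith [hx.2]) d
      (by have := j.2; omega)).2
    linarith [hx'.1]
  have hdisj : Pairwise (Function.onFun Disjoint fun i : Fin N => PF a i E) := by
    intro i j hij
    rcases lt_or_gt_of_ne hij with h | h
    · exact key i j h
    · exact (key j i h).symm
  have hsum : ∑' i : Fin N, volume (PF a i E) ≤ 1 := by
    rw [← measure_iUnion hdisj (fun i => PF_meas ha _ (hE.trans hsub) hEm), ← vol_II]
    exact measure_mono (iUnion_subset fun i => PF_sub)
  have hcover : {x | x ∈ II ∧ ∃ n < N, (lsv a)^[n] x ∈ H} ⊆ ⋃ i : Fin N, PF a i H := by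
    rintro x ⟨hx, n, hn, h⟩
    exact mem_iUnion.mpr ⟨⟨n, hn⟩, hx, h⟩
  rw [← volE]
  calc _ ≤ (∑' i : Fin N, volume (PF a i H)) * volume E := by
        gcongr
        exact (measure_mono hcover).trans (measure_iUnion_le _)
    _ = ∑' i : Fin N, volume (PF a i H) * volume E := ENNReal.tsum_mul_right.symm
    _ ≤ ∑' i : Fin N, KK a * volume H * volume (PF a i E) := by
        refine ENNReal.tsum_le_tsum fun i => ?_
        have := F_compare ha hH hm hE hEm i id (Adm.id ha)
        rwa [image_id, image_id] at this
    _ = KK a * volume H * ∑' i : Fin N, volume (PF a i E) := ENNReal.tsum_mul_left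
    _ ≤ KK a * volume H * 1 := by gcongr
    _ = _ := mul_one _

lemma bc_help {s : ℕ → Set ℝ} {b : ℕ → ℝ} {K : ENNReal} (hK : K ≠ ⊤) (j0 : ℕ)
    (hb0 : ∀ j, 0 ≤ b j) (hb : Summable b)
    (h : ∀ j, j0 ≤ j → volume (s j) ≤ K * ENNReal.ofReal (b j)) :
    ∀ᵐ x ∂(volume : Measure ℝ), ∀ᶠ j in atTop, x ∉ s j := by
  have h1 : ∑' j, volume (s (j + j0)) ≠ ⊤ := by
    have h2 : ∑' j, volume (s (j + j0)) ≤ ∑' j, K * ENNReal.ofReal (b (j + j0)) :=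
      ENNReal.tsum_le_tsum fun j => h _ (by omega)
    refine ne_top_of_le_ne_top ?_ h2
    rw [ENNReal.tsum_mul_left]
    refine ENNReal.mul_ne_top hK ?_
    have h3 : Summable fun j => b (j + j0) := (summable_nat_add_iff j0).2 hb
    rw [← ENNReal.ofReal_tsum_of_nonneg (fun j => hb0 _) h3]
    exact ENNReal.ofReal_ne_top
  filter_upwards [ae_eventually_notMem h1] with x hx
  rw [eventually_atTop] at hx ⊢
  obtain ⟨N, hN⟩ := hx
  refine ⟨N + j0, fun j hj => ?_⟩
  have := hN (j - j0) (by omega)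
  rwa [Nat.sub_add_cancel (by omega)] at this

lemma two_rpow_neg_nat (j : ℕ) : (2:ℝ) ^ (-(j:ℝ)) = (1 / 2) ^ j := by
  rw [Real.rpow_neg (by norm_num), Real.rpow_natCast, one_div, inv_pow]

lemma summable_geo {c : ℝ} (hc : 0 < c) : Summable fun j : ℕ => ((j:ℝ) + 1) * (2:ℝ) ^ (-(c * j)) := by
  have e : ∀ j : ℕ, (2:ℝ) ^ (-(c * j)) = ((2:ℝ) ^ (-c)) ^ j := by
    intro j
    rw [← Real.rpow_natCast, ← Real.rpow_mul (by norm_num)]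
    ring_nf
  have h1 : (2:ℝ) ^ (-c) < 1 := Real.rpow_lt_one_of_one_lt_of_neg (by norm_num) (by linarith)
  have h0 : (0:ℝ) ≤ (2:ℝ) ^ (-c) := by positivity
  have s1 := summable_pow_mul_geometric_of_norm_lt_one 1
    (r := (2:ℝ) ^ (-c)) (by rwa [Real.norm_of_nonneg h0])
  have s2 := summable_geometric_of_lt_one h0 h1
  refine (s1.add s2).congr fun j => ?_
  rw [e]; ring

/-- Target set seen from the lower bound. -/
def HH (xt r : ℝ) : Set ℝ := (Ico (1 / 2) (1 / 2 + r) ∪ Ioo (xt - r) (xt + r)) ∩ Ico (1 / 2) 1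

lemma HH_vol {xt r : ℝ} (hr : 0 ≤ r) : volume (HH xt r) ≤ ENNReal.ofReal (3 * r) := by
  refine (measure_mono inter_subset_left).trans ((measure_union_le _ _).trans ?_)
  rw [Real.volume_Ico, Real.volume_Ioo, ← ENNReal.ofReal_add (by linarith) (by linarith)]
  apply le_of_eq; congr 1; ring

lemma HH_meas (xt r : ℝ) : MeasurableSet (HH xt r) :=
  (measurableSet_Ico.union measurableSet_Ioo).inter measurableSet_Ico

lemma lsv_ge {a x : ℝ} (hx0 : 0 ≤ x) (hx : x < 1 / 2) : x ≤ lsv a x := by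
  rw [lsv, if_pos hx]
  have : 0 ≤ (2:ℝ) ^ a * x ^ a := by positivity
  nlinarith

lemma back_small {a xt r x : ℝ} (ha : 1 ≤ a) (hx : x ∈ II) (hrx : r < x) (n : ℕ)
    (h : (lsv a)^[n] x < r) : ∃ j ≤ n, (lsv a)^[j] x ∈ HH xt r := by
  induction n with
  | zero => simp only [Function.iterate_zero, id] at h; linarith
  | succ n ih =>
    have hm := lsv_iter_mem ha (II_sub_Ico hx) n
    rw [Function.iterate_succ_apply'] at h
    by_cases hl : (lsv a)^[n] x < 1 / 2
    · have := lsv_ge (a := a) hm.1 hl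
      obtain ⟨j, hj, hj'⟩ := ih (by linarith)
      exact ⟨j, by omega, hj'⟩
    · rw [lsv_right (not_lt.1 hl)] at h
      refine ⟨n, by omega, Or.inl ⟨not_lt.1 hl, ?_⟩, ⟨not_lt.1 hl, hm.2⟩⟩
      linarith [hm.2, not_lt.1 hl]

lemma hit_HH {a xt r x : ℝ} (ha : 1 ≤ a) (hxt : xt ∈ Ioc (1 / 2 : ℝ) 1) (hx : x ∈ II) (hrx : r < x)
    (hr : r < xt - 1 / 2) (hr1 : xt < 1 → r < 1 - xt) (n : ℕ)
    (h : circDist ((lsv a)^[n] x) xt < r) : ∃ j ≤ n, (lsv a)^[j] x ∈ HH xt r := by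
  have hm := lsv_iter_mem ha (II_sub_Ico hx) n
  unfold circDist at h
  rcases min_lt_iff.1 h with h | h
  · rw [abs_lt] at h
    exact ⟨n, le_rfl, Or.inr ⟨by linarith, by linarith⟩, by linarith, hm.2⟩
  · refine back_small ha hx hrx n ?_
    rcases hxt.2.lt_or_eq with h1 | h1
    · exfalso
      have := hr1 h1
      have h3 : |(lsv a)^[n] x - xt| < 1 - r := by
        rw [abs_lt]; constructor <;> linarith [hm.1, hm.2, hxt.1]
      linarith
    · rw [h1, abs_of_neg (by linarith [hm.2])] at h
      linarith

lemma inv_dl_le {a : ℝ} (ha : 1 ≤ a) {γ : ℝ} (hγ : 0 < γ) :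
    ∃ C : ℝ, 0 < C ∧ ∀ j : ℕ, (dl a ⌈(2:ℝ) ^ (γ * j)⌉₊)⁻¹ ≤ C * 2 ^ (γ / a * j) := by
  refine ⟨((2:ℝ) ^ a * (1 + 2 * a)) ^ (1 / a), by positivity, fun j => ?_⟩
  have h1 : (1:ℝ) ≤ (2:ℝ) ^ (γ * j) := Real.one_le_rpow (by norm_num) (by positivity)
  have h2 : (⌈(2:ℝ) ^ (γ * j)⌉₊ : ℝ) ≤ 2 * (2:ℝ) ^ (γ * j) := by
    have := (Nat.ceil_lt_add_one (a := (2:ℝ) ^ (γ * j)) (by positivity)).le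
    linarith
  have h3 : (2:ℝ) ^ (γ / a * j) = ((2:ℝ) ^ (γ * j)) ^ (1 / a) := by
    rw [← Real.rpow_mul (by norm_num)]; congr 1; ring
  rw [dl, Real.rpow_neg (by positivity), inv_inv, h3, ← Real.mul_rpow (by positivity) (by positivity)]
  refine Real.rpow_le_rpow (by positivity) ?_ (by positivity)
  have h4 : (0:ℝ) < 2 ^ a := by positivity
  have h5 : a * 2 ^ a * (⌈(2:ℝ) ^ (γ * j)⌉₊ : ℝ) ≤ a * 2 ^ a * (2 * (2:ℝ) ^ (γ * j)) := by gcongr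
  nlinarith

lemma lower_ae {a : ℝ} (ha : 1 ≤ a) {xt : ℝ} (hxt : xt ∈ Ioc (1 / 2 : ℝ) 1) {γ : ℝ} (hγ : 0 < γ)
    (hγa : γ < a) : ∀ᵐ x ∂(volume : Measure ℝ), x ∈ II → ∀ᶠ j : ℕ in atTop, ∀ n : ℕ, 1 ≤ n →
      circDist ((lsv a)^[n] x) xt < (1 / 2) ^ j → (2:ℝ) ^ (γ * j) ≤ n := by
  obtain ⟨C, hC, hdl⟩ := inv_dl_le ha hγ
  set s : ℕ → Set ℝ := fun j =>
    {x | x ∈ II ∧ ∃ n < ⌈(2:ℝ) ^ (γ * j)⌉₊, (lsv a)^[n] x ∈ HH xt ((1 / 2) ^ j)} with hs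
  have hc : 0 < 1 - γ / a := by
    have : γ / a < 1 := (div_lt_one (by linarith)).2 hγa
    linarith
  have main : ∀ᵐ x ∂(volume : Measure ℝ), ∀ᶠ j in atTop, x ∉ s j := by
    refine bc_help (K := KK a * ENNReal.ofReal (6 * C)) (ENNReal.mul_ne_top (KK_ne_top a) ENNReal.ofReal_ne_top) 0
      (b := fun j : ℕ => ((j:ℝ) + 1) * (2:ℝ) ^ (-((1 - γ / a) * j))) (fun j => by positivity)
      (summable_geo hc) fun j _ => ?_
    set N := ⌈(2:ℝ) ^ (γ * j)⌉₊ with hN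
    have h1 := hit_low ha N (H := HH xt ((1 / 2) ^ j)) inter_subset_right (HH_meas _ _)
    have hd := dl_pos ha N
    have hd' : ENNReal.ofReal (dl a N / 2) ≠ 0 := by
      rw [Ne, ENNReal.ofReal_eq_zero]; linarith
    have h2 : volume (s j) ≤ KK a * volume (HH xt ((1 / 2) ^ j)) / ENNReal.ofReal (dl a N / 2) := by
      rw [ENNReal.le_div_iff_mul_le (Or.inl hd') (Or.inl ENNReal.ofReal_ne_top)]
      exact h1
    refine h2.trans ?_
    rw [mul_div_assoc, mul_assoc]
    gcongr
    refine (ENNReal.div_le_div_right (HH_vol (by positivity)) _).trans ?_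
    rw [← ENNReal.ofReal_div_of_pos (by linarith), ← ENNReal.ofReal_mul (by positivity)]
    apply ENNReal.ofReal_le_ofReal
    have h3 := hdl j
    rw [← hN] at h3
    have e : (2:ℝ) ^ (-((1 - γ / a) * j)) = (1 / 2) ^ j * 2 ^ (γ / a * j) := by
      rw [← two_rpow_neg_nat, ← Real.rpow_add (by norm_num)]; congr 1; ring
    have e2 : 3 * (1 / 2 : ℝ) ^ j / (dl a N / 2) = 6 * (1 / 2) ^ j * (dl a N)⁻¹ := by
      field_simp; norm_num
    rw [e2, e]
    have p1 : (0:ℝ) < (1 / 2) ^ j := by positivity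
    have p2 : (0:ℝ) < 2 ^ (γ / a * j) := by positivity
    have p3 : (0:ℝ) ≤ j := by positivity
    calc 6 * (1 / 2) ^ j * (dl a N)⁻¹ ≤ 6 * (1 / 2) ^ j * (C * 2 ^ (γ / a * j)) := by gcongr
      _ = 6 * C * (1 * ((1 / 2) ^ j * 2 ^ (γ / a * j))) := by ring
      _ ≤ 6 * C * (((j:ℝ) + 1) * ((1 / 2) ^ j * 2 ^ (γ / a * j))) := by gcongr; linarith
  have hlim : Tendsto (fun j : ℕ => (1 / 2 : ℝ) ^ j) atTop (nhds 0) :=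
    tendsto_pow_atTop_nhds_zero_of_lt_one (by norm_num) (by norm_num)
  filter_upwards [main] with x hx hxI
  have e1 : ∀ᶠ j : ℕ in atTop, (1 / 2 : ℝ) ^ j < x := hlim.eventually_lt_const hxI.1
  have e2 : ∀ᶠ j : ℕ in atTop, (1 / 2 : ℝ) ^ j < xt - 1 / 2 :=
    hlim.eventually_lt_const (by linarith [hxt.1])
  have e3 : ∀ᶠ j : ℕ in atTop, xt < 1 → (1 / 2 : ℝ) ^ j < 1 - xt := by
    by_cases h : xt < 1
    · filter_upwards [hlim.eventually_lt_const (u := 1 - xt) (by linarith)] with j hj _ using hj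
    · exact Eventually.of_forall fun _ h' => absurd h' h
  filter_upwards [hx, e1, e2, e3] with j h0 h1 h2 h3 n _ hd
  by_contra hlt
  rw [not_le] at hlt
  obtain ⟨i, hi, hi'⟩ := hit_HH ha hxt hxI h1 h2 h3 n hd
  have : n < ⌈(2:ℝ) ^ (γ * j)⌉₊ := Nat.lt_ceil.2 hlt
  exact h0 ⟨hxI, i, by omega, hi'⟩

lemma lsv_measurable (a : ℝ) : Measurable (lsv a) := by
  unfold lsv
  refine Measurable.ite measurableSet_Iio ?_ ?_ <;> fun_prop

lemma RR_measurable (a : ℝ) : Measurable (RR a) := by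
  have hm : ∀ n, Measurable ((lsv a)^[n]) := fun n => (lsv_measurable a).iterate n
  have key : ∀ n : ℕ, MeasurableSet {x | n < RR a x} := by
    intro n
    have : {x | n < RR a x} =
        (⋃ m, {x | 1 / 2 ≤ (lsv a)^[m] x}) ∩ ⋂ i ∈ Finset.range (n + 1), {x | (lsv a)^[i] x < 1 / 2} := by
      ext x
      simp only [mem_ofPred_eq, mem_inter_iff, mem_iUnion, mem_iInter, Finset.mem_range]
      constructor
      · intro h
        refine ⟨?_, fun i hi => RR_min (by omega)⟩
        have : {n : ℕ | 1 / 2 ≤ (lsv a)^[n] x}.Nonempty := by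
          by_contra h'
          rw [Set.not_nonempty_iff_eq_empty] at h'
          rw [RR, h', Nat.sInf_empty] at h
          omega
        exact this
      · rintro ⟨h1, h2⟩
        by_contra h3
        have h4 : 1 / 2 ≤ (lsv a)^[RR a x] x := Nat.sInf_mem (s := {n : ℕ | 1 / 2 ≤ (lsv a)^[n] x}) h1
        have := h2 (RR a x) (by omega)
        linarith
    rw [this]
    refine (MeasurableSet.iUnion fun m => measurableSet_le measurable_const (hm m)).inter
      (Finset.measurableSet_biInter _ fun i _ => measurableSet_lt (hm i) measurable_const)
  exact measurable_of_Ioi key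

lemma GG_measurable (a : ℝ) : Measurable (GG a) := by
  have hm : ∀ n, Measurable ((lsv a)^[n]) := fun n => (lsv_measurable a).iterate n
  have h : Measurable (fun p : ℕ × ℝ => (lsv a)^[p.1 + 1] p.2) :=
    measurable_from_prod_countable_right fun n => hm (n + 1)
  exact h.comp ((RR_measurable a).prodMk measurable_id)

/-- The moment observable. -/
def gq (q : ℝ) : ℝ → ENNReal := II.indicator fun x => ENNReal.ofReal (x ^ (-q))

lemma gq_meas (q : ℝ) : Measurable (gq q) := by
  unfold gq
  refine Measurable.indicator ?_ measurableSet_Ioo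
  fun_prop

lemma gq_fin {q : ℝ} (hq1 : q < 1) : ∫⁻ x in II, gq q x ≠ ⊤ := by
  have h1 : IntervalIntegrable (fun x : ℝ => x ^ (-q)) volume 0 1 :=
    intervalIntegral.intervalIntegrable_rpow' (by linarith)
  rw [intervalIntegrable_iff_integrableOn_Ioo_of_le (by norm_num)] at h1
  have h2 := h1.lintegral_lt_top
  have h3 : ∫⁻ x in II, gq q x = ∫⁻ x in II, ENNReal.ofReal (x ^ (-q)) := by
    refine setLIntegral_congr_fun measurableSet_Ioo fun x hx => ?_
    simp only [gq, indicator_of_mem hx]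
  rw [h3]
  exact h2.ne

lemma moment {a : ℝ} (ha : 1 ≤ a) (q : ℝ) (i : ℕ) :
    ∫⁻ x in II, gq q ((GG a)^[i] x) ≤ KK a * ∫⁻ x in II, gq q x := by
  have hG : Measurable ((GG a)^[i]) := (GG_measurable a).iterate i
  have hle : (Measure.map ((GG a)^[i]) (volume.restrict II)).restrict II ≤ KK a • volume.restrict II := by
    refine Measure.le_iff.2 fun s hs => ?_
    rw [Measure.restrict_apply hs, Measure.map_apply hG (hs.inter measurableSet_Ioo),
      Measure.restrict_apply (hG (hs.inter measurableSet_Ioo)), Measure.smul_apply, smul_eq_mul,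
      Measure.restrict_apply hs]
    have := PG_upper ha (E := s ∩ II) inter_subset_right (hs.inter measurableSet_Ioo) i
    refine le_trans (measure_mono ?_) this
    rintro x ⟨h1, h2⟩
    exact ⟨h2, h1⟩
  have e1 : ∫⁻ x in II, gq q ((GG a)^[i] x)
      = ∫⁻ y in II, gq q y ∂(Measure.map ((GG a)^[i]) (volume.restrict II)) := by
    rw [← lintegral_map (gq_meas q) hG, ← lintegral_indicator measurableSet_Ioo]
    congr 1
    ext x
    simp only [gq, indicator_indicator, inter_self]
  rw [e1]
  calc _ ≤ ∫⁻ y, gq q y ∂(KK a • volume.restrict II) := lintegral_mono' hle le_rfl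
    _ = _ := by rw [lintegral_smul_measure, smul_eq_mul]

/-- The set where the moment sum is large. -/
def Big (a q : ℝ) (L : ℕ) (t : ℝ) : Set ℝ :=
  {x | x ∈ II ∧ ENNReal.ofReal t ≤ ∑ i ∈ Finset.range L, gq q ((GG a)^[i] x)}

lemma Big_bound {a : ℝ} (ha : 1 ≤ a) (q : ℝ) (L : ℕ) {t : ℝ} :
    ENNReal.ofReal t * volume (Big a q L t) ≤ L * (KK a * ∫⁻ x in II, gq q x) := by
  have hGm : ∀ i, Measurable fun x => gq q ((GG a)^[i] x) := fun i =>
    (gq_meas q).comp ((GG_measurable a).iterate i)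
  have hm : Measurable fun x => ∑ i ∈ Finset.range L, gq q ((GG a)^[i] x) :=
    Finset.measurable_fun_sum _ fun i _ => hGm i
  have h1 := mul_meas_ge_le_lintegral (μ := volume.restrict II) hm (ENNReal.ofReal t)
  rw [Measure.restrict_apply (measurableSet_le measurable_const hm),
    lintegral_finsetSum _ fun i _ => hGm i] at h1
  have e : Big a q L t = {x | ENNReal.ofReal t ≤ ∑ i ∈ Finset.range L, gq q ((GG a)^[i] x)} ∩ II := by
    ext x; exact and_comm
  rw [e]
  refine h1.trans ((Finset.sum_le_sum fun i _ => moment ha q i).trans ?_)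
  simp

/-- Accumulated time. -/
def TT (a : ℝ) (k : ℕ) (x : ℝ) : ℕ := ∑ i ∈ Finset.range k, (RR a ((GG a)^[i] x) + 1)

lemma TT_iter {a : ℝ} (k : ℕ) (x : ℝ) : (lsv a)^[TT a k x] x = (GG a)^[k] x := by
  induction k with
  | zero => simp [TT]
  | succ k ih =>
    have : TT a (k + 1) x = (RR a ((GG a)^[k] x) + 1) + TT a k x := by
      rw [TT, Finset.sum_range_succ, add_comm]; rfl
    rw [this, Function.iterate_add_apply, ih, Function.iterate_succ_apply' (GG a)]
    rfl

lemma sum_rpow_le {ι : Type*} (s : Finset ι) (y : ι → ℝ) (hy : ∀ i ∈ s, 0 < y i) {p : ℝ} (hp : 1 ≤ p) :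
    ∑ i ∈ s, y i ^ p ≤ (∑ i ∈ s, y i) ^ p := by
  rcases s.eq_empty_or_nonempty with rfl | hne
  · simp [Real.zero_rpow (by linarith : p ≠ 0)]
  have hS : 0 < ∑ i ∈ s, y i := Finset.sum_pos hy hne
  have e : ∀ z : ℝ, 0 < z → z ^ p = z * z ^ (p - 1) := by
    intro z hz
    rw [← Real.rpow_one_add' hz.le (by linarith)]; congr 1; ring
  rw [e _ hS, Finset.sum_mul]
  refine Finset.sum_le_sum fun i hi => ?_
  rw [e _ (hy i hi)]
  refine mul_le_mul_of_nonneg_left ?_ (hy i hi).le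
  exact Real.rpow_le_rpow (hy i hi).le (Finset.single_le_sum (fun j hj => (hy j hj).le) hi) (by linarith)

lemma TT_bound {a : ℝ} (ha : 1 ≤ a) {q : ℝ} (hq : 0 < q) (hq1 : q < 1) {L k : ℕ} {t x : ℝ}
    (hx : x ∈ II) (hxB : x ∉ Big a q (L + 2) t) (hk : k < L) (hG : (GG a)^[k + 2] x ∈ II) (ht : 0 ≤ t) :
    (TT a (k + 2) x : ℝ) ≤ 2 * t ^ (a / q) := by
  have hmem : ∀ i ∈ Finset.range (k + 2), (GG a)^[i] x ∈ II := by
    intro i hi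
    rw [Finset.mem_range] at hi
    obtain ⟨d, hd⟩ : ∃ d, k + 2 = d + i := ⟨k + 2 - i, by omega⟩
    rw [hd] at hG
    exact GG_iter_memI ha hx d i hG
  have h1 : ∑ i ∈ Finset.range (k + 2), ((GG a)^[i] x) ^ (-q) ≤ t := by
    have h2 : ∑ i ∈ Finset.range (L + 2), gq q ((GG a)^[i] x) < ENNReal.ofReal t := by
      by_contra h; exact hxB ⟨hx, not_lt.1 h⟩
    have h3 : ∑ i ∈ Finset.range (k + 2), gq q ((GG a)^[i] x) ≤
        ∑ i ∈ Finset.range (L + 2), gq q ((GG a)^[i] x) :=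
      Finset.sum_le_sum_of_subset (Finset.range_mono (by omega))
    have h4 : ∑ i ∈ Finset.range (k + 2), gq q ((GG a)^[i] x)
        = ENNReal.ofReal (∑ i ∈ Finset.range (k + 2), ((GG a)^[i] x) ^ (-q)) := by
      rw [ENNReal.ofReal_sum_of_nonneg fun i hi => (Real.rpow_pos_of_pos (hmem i hi).1 _).le]
      refine Finset.sum_congr rfl fun i hi => ?_
      simp only [gq, indicator_of_mem (hmem i hi)]
    have h5 := h3.trans h2.le
    rw [h4] at h5
    exact (ENNReal.ofReal_le_ofReal_iff ht).1 h5
  have hp : 1 ≤ a / q := by rw [le_div_iff₀ hq]; linarith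
  have h6 := sum_rpow_le (Finset.range (k + 2)) (fun i => ((GG a)^[i] x) ^ (-q))
    (fun i hi => Real.rpow_pos_of_pos (hmem i hi).1 _) hp
  have h7 : (∑ i ∈ Finset.range (k + 2), ((GG a)^[i] x) ^ (-q)) ^ (a / q) ≤ t ^ (a / q) :=
    Real.rpow_le_rpow (Finset.sum_nonneg fun i hi => (Real.rpow_pos_of_pos (hmem i hi).1 _).le) h1
      (by positivity)
  have h8 : (TT a (k + 2) x : ℝ) ≤ ∑ i ∈ Finset.range (k + 2), 2 * (((GG a)^[i] x) ^ (-q)) ^ (a / q) := by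
    rw [TT]; push_cast
    refine Finset.sum_le_sum fun i hi => ?_
    have hi' := hmem i hi
    rw [← Real.rpow_mul hi'.1.le, show -q * (a / q) = -a by field_simp]
    have := RR_le ha hi'
    have h9 : 1 ≤ ((GG a)^[i] x) ^ (-a) :=
      Real.one_le_rpow_of_pos_of_le_one_of_nonpos hi'.1 hi'.2.le (by linarith)
    linarith
  rw [← Finset.mul_sum] at h8
  linarith

lemma hit_exists {a : ℝ} (ha : 1 ≤ a) {xt r : ℝ} (hxt : xt ∈ Ioc (1 / 2 : ℝ) 1) (hr : 0 < r)
    (hr1 : r < xt - 1 / 2)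
    {q : ℝ} (hq : 0 < q) (hq1 : q < 1) {L : ℕ} {t x : ℝ} (ht : 0 ≤ t)
    (hx : x ∈ II) (hxB : x ∉ Big a q (L + 2) t)
    (hxA : x ∉ Avoid a L (Ioo (2 * xt - 1 - 2 * r) (2 * xt - 1))) :
    ∃ n : ℕ, 1 ≤ n ∧ (n:ℝ) ≤ 2 * t ^ (a / q) ∧ circDist ((lsv a)^[n] x) xt < r := by
  have : ∃ k < L, (GG a)^[k + 2] x ∈ Ioo (2 * xt - 1 - 2 * r) (2 * xt - 1) := by
    by_contra h
    push Not at h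
    exact hxA ⟨hx, h⟩
  obtain ⟨k, hk, hG⟩ := this
  have hGI : (GG a)^[k + 2] x ∈ II := ⟨by linarith [hG.1], by linarith [hG.2, hxt.2]⟩
  have hT := TT_bound ha hq hq1 hx hxB hk hGI ht
  have hI1 : (GG a)^[k + 1] x ∈ II := by
    rw [show k + 2 = 1 + (k + 1) by ring] at hGI
    exact GG_iter_memI ha hx 1 (k + 1) hGI
  have hTs : TT a (k + 2) x = TT a (k + 1) x + (RR a ((GG a)^[k + 1] x) + 1) := by
    rw [TT, Finset.sum_range_succ]; rfl
  have hT1 : 1 ≤ TT a (k + 1) x := by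
    rw [TT, Finset.sum_range_succ]; omega
  refine ⟨RR a ((GG a)^[k + 1] x) + TT a (k + 1) x, by omega, ?_, ?_⟩
  · refine le_trans ?_ hT
    rw [hTs]; push_cast; linarith
  · rw [Function.iterate_add_apply, TT_iter, GG_eq ha hI1, ← Function.iterate_succ_apply' (GG a)]
    refine lt_of_le_of_lt (min_le_left _ _) ?_
    rw [abs_lt]
    unfold phi1
    have h1 := hG.1
    have h2 := hG.2
    constructor <;> linarith

lemma avoid_vol {a : ℝ} (ha : 1 ≤ a) {xt : ℝ} (hxt : xt ∈ Ioc (1 / 2 : ℝ) 1) {e : ℝ}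
    (j : ℕ) (hj : (1 / 2 : ℝ) ^ j < xt - 1 / 2) :
    volume (Avoid a ((j + 3) * ⌈(2:ℝ) ^ ((1 + e) * j)⌉₊)
      (Ioo (2 * xt - 1 - 2 * (1 / 2) ^ j) (2 * xt - 1))) ≤
      KK a * KK a * ENNReal.ofReal ((2:ℝ) ^ (-(e * j))) := by
  set r : ℝ := (1 / 2) ^ j with hr
  have r0 : 0 < r := by positivity
  set L' := ⌈(2:ℝ) ^ ((1 + e) * j)⌉₊ with hL
  have e1 : (2 * xt - 1 - 3 * r / 2) - r / 2 = 2 * xt - 1 - 2 * r := by ring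
  have e2 : (2 * xt - 1 - r / 2) + r / 2 = 2 * xt - 1 := by ring
  have h := Avoid_bound ha (u := 2 * xt - 1 - 3 * r / 2) (v := 2 * xt - 1 - r / 2) (η := r / 2)
    (j + 1) L' (Ioo_subset_Ioo (by linarith) (by linarith [hxt.2]))
    (by rw [e1, e2]; exact Ioo_subset_Ioo (by linarith) (by linarith [hxt.2]))
    (by rw [pow_succ]; apply le_of_eq; rw [hr]; ring)
  rw [e1, e2, show j + 1 + 2 = j + 3 by ring, Real.volume_Ioo,
    show 2 * xt - 1 - r / 2 - (2 * xt - 1 - 3 * r / 2) = r by ring, ← mul_assoc] at h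
  set V := volume (Avoid a ((j + 3) * L') (Ioo (2 * xt - 1 - 2 * r) (2 * xt - 1))) with hV
  have h2 : ENNReal.ofReal ((2:ℝ) ^ (e * j)) ≤ (L' : ENNReal) * ENNReal.ofReal r := by
    rw [← ENNReal.ofReal_natCast, ← ENNReal.ofReal_mul (by positivity)]
    apply ENNReal.ofReal_le_ofReal
    have h3 : (2:ℝ) ^ ((1 + e) * j) ≤ L' := Nat.le_ceil _
    have h4 : (2:ℝ) ^ (e * j) = (2:ℝ) ^ ((1 + e) * j) * r := by
      rw [hr, ← two_rpow_neg_nat, ← Real.rpow_add (by norm_num)]; congr 1; ring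
    rw [h4]; gcongr
  have h5 : ENNReal.ofReal ((2:ℝ) ^ (e * j)) * V ≤ KK a * KK a := le_trans (by gcongr) h
  have h6 : ENNReal.ofReal ((2:ℝ) ^ (e * j)) ≠ 0 := by
    rw [Ne, ENNReal.ofReal_eq_zero, not_le]; positivity
  rw [Real.rpow_neg (by norm_num), ENNReal.ofReal_inv_of_pos (by positivity), ← div_eq_mul_inv,
    ENNReal.le_div_iff_mul_le (Or.inl h6) (Or.inl ENNReal.ofReal_ne_top), mul_comm]
  exact h5

lemma big_vol {a : ℝ} (ha : 1 ≤ a) (q : ℝ) {e : ℝ} (he : 0 < e) (j : ℕ) :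
    volume (Big a q ((j + 3) * ⌈(2:ℝ) ^ ((1 + e) * j)⌉₊ + 2) ((2:ℝ) ^ ((1 + 2 * e) * j))) ≤
      (KK a * ∫⁻ x in II, gq q x) * ENNReal.ofReal (8 * (((j:ℝ) + 1) * (2:ℝ) ^ (-(e * j)))) := by
  set L' := ⌈(2:ℝ) ^ ((1 + e) * j)⌉₊ with hL
  have h := Big_bound ha q ((j + 3) * L' + 2) (t := (2:ℝ) ^ ((1 + 2 * e) * j))
  have h6 : ENNReal.ofReal ((2:ℝ) ^ ((1 + 2 * e) * j)) ≠ 0 := by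
    rw [Ne, ENNReal.ofReal_eq_zero, not_le]; positivity
  rw [mul_comm, ← ENNReal.le_div_iff_mul_le (Or.inl h6) (Or.inl ENNReal.ofReal_ne_top)] at h
  refine h.trans ?_
  rw [mul_comm, mul_div_assoc]
  gcongr
  rw [← ENNReal.ofReal_natCast, ← ENNReal.ofReal_div_of_pos (by positivity)]
  apply ENNReal.ofReal_le_ofReal
  rw [div_le_iff₀ (by positivity)]
  have h1 : (1:ℝ) ≤ (2:ℝ) ^ ((1 + e) * j) := Real.one_le_rpow (by norm_num) (by positivity)
  have h2 : (L' : ℝ) ≤ 2 * (2:ℝ) ^ ((1 + e) * j) := by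
    have := (Nat.ceil_lt_add_one (a := (2:ℝ) ^ ((1 + e) * j)) (by positivity)).le
    linarith
  have h3 : (2:ℝ) ^ (-(e * j)) * (2:ℝ) ^ ((1 + 2 * e) * j) = (2:ℝ) ^ ((1 + e) * j) := by
    rw [← Real.rpow_add (by norm_num)]; congr 1; ring
  rw [mul_assoc, mul_assoc, h3]
  push_cast
  have hj : (0:ℝ) ≤ j := by positivity
  have h4 : ((j:ℝ) + 3) * L' ≤ ((j:ℝ) + 3) * (2 * (2:ℝ) ^ ((1 + e) * j)) := by gcongr
  nlinarith

lemma upper_ae {a : ℝ} (ha : 1 ≤ a) {xt : ℝ} (hxt : xt ∈ Ioc (1 / 2 : ℝ) 1) {β : ℝ} (hβ : a < β) :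
    ∀ᵐ x ∂(volume : Measure ℝ), x ∈ II → ∀ᶠ j : ℕ in atTop, ∃ n : ℕ, 1 ≤ n ∧
      (n:ℝ) ≤ 2 * (2:ℝ) ^ (β * j) ∧ circDist ((lsv a)^[n] x) xt < (1 / 2) ^ j := by
  obtain ⟨e, he, heb⟩ : ∃ e : ℝ, 0 < e ∧ (1 + 2 * e) * (a * (1 + e)) ≤ β := by
    refine ⟨min 1 ((β - a) / (5 * a)), lt_min one_pos (div_pos (by linarith) (by linarith)), ?_⟩
    set e := min 1 ((β - a) / (5 * a)) with he
    have h1 : e ≤ 1 := min_le_left _ _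
    have h2 : e ≤ (β - a) / (5 * a) := min_le_right _ _
    have h0 : 0 < e := lt_min one_pos (div_pos (by linarith) (by linarith))
    rw [le_div_iff₀ (by linarith)] at h2
    have h3 : e * e ≤ e := by nlinarith
    have h4 : a * (e * e) ≤ a * e := by gcongr
    nlinarith
  set q : ℝ := 1 / (1 + e) with hq
  have q0 : 0 < q := by positivity
  have q1 : q < 1 := by rw [hq, div_lt_one (by linarith)]; linarith
  have hlim : Tendsto (fun j : ℕ => (1 / 2 : ℝ) ^ j) atTop (nhds 0) :=
    tendsto_pow_atTop_nhds_zero_of_lt_one (by norm_num) (by norm_num)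
  have ev : ∀ᶠ j : ℕ in atTop, (1 / 2 : ℝ) ^ j < xt - 1 / 2 :=
    hlim.eventually_lt_const (by linarith [hxt.1])
  obtain ⟨j0, hj0⟩ := eventually_atTop.1 ev
  have hA : ∀ᵐ x ∂(volume : Measure ℝ), ∀ᶠ j : ℕ in atTop,
      x ∉ Avoid a ((j + 3) * ⌈(2:ℝ) ^ ((1 + e) * j)⌉₊)
        (Ioo (2 * xt - 1 - 2 * (1 / 2) ^ j) (2 * xt - 1)) := by
    refine bc_help (ENNReal.mul_ne_top (KK_ne_top a) (KK_ne_top a)) j0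
      (b := fun j : ℕ => ((j:ℝ) + 1) * (2:ℝ) ^ (-(e * j))) (fun j => by positivity)
      (summable_geo he) fun j hj => ?_
    refine (avoid_vol ha hxt j (hj0 j hj)).trans ?_
    gcongr
    have : (0:ℝ) ≤ j := by positivity
    exact le_mul_of_one_le_left (by positivity) (by linarith)
  have hB : ∀ᵐ x ∂(volume : Measure ℝ), ∀ᶠ j : ℕ in atTop,
      x ∉ Big a q ((j + 3) * ⌈(2:ℝ) ^ ((1 + e) * j)⌉₊ + 2) ((2:ℝ) ^ ((1 + 2 * e) * j)) := by
    exact bc_help (ENNReal.mul_ne_top (KK_ne_top a) (gq_fin q1)) 0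
      (b := fun j : ℕ => 8 * (((j:ℝ) + 1) * (2:ℝ) ^ (-(e * j)))) (fun j => by positivity)
      ((summable_geo he).mul_left 8) fun j _ => big_vol ha q he j
  filter_upwards [hA, hB] with x hxA hxB hx
  filter_upwards [hxA, hxB, ev] with j h1 h2 h3
  obtain ⟨n, hn1, hn2, hn3⟩ := hit_exists ha hxt (by positivity) h3 q0 q1 (by positivity) hx h2 h1
  refine ⟨n, hn1, hn2.trans ?_, hn3⟩
  rw [← Real.rpow_mul (by norm_num)]
  have : a / q = a * (1 + e) := by rw [hq]; field_simp
  rw [this]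
  refine mul_le_mul_of_nonneg_left (Real.rpow_le_rpow_of_exponent_le (by norm_num) ?_) (by norm_num)
  have hj : (0:ℝ) ≤ j := by positivity
  nlinarith [mul_le_mul_of_nonneg_right heb hj]

lemma log_final {a xt x : ℝ} (ha : 1 ≤ a)
    (hl : ∀ γ : ℝ, 0 < γ → γ < a → ∃ γ', γ < γ' ∧ ∀ᶠ j : ℕ in atTop, ∀ n : ℕ, 1 ≤ n →
      circDist ((lsv a)^[n] x) xt < (1 / 2) ^ j → (2:ℝ) ^ (γ' * j) ≤ n)
    (hu : ∀ β : ℝ, a < β → ∃ β', 0 < β' ∧ β' < β ∧ ∀ᶠ j : ℕ in atTop, ∃ n : ℕ, 1 ≤ n ∧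
      (n:ℝ) ≤ 2 * (2:ℝ) ^ (β' * j) ∧ circDist ((lsv a)^[n] x) xt < (1 / 2) ^ j) :
    Tendsto (fun r : ℝ => Real.log ((hitBall (lsv a) xt r x : ℕ) : ℝ) / (- Real.log r))
        (nhdsWithin 0 (Set.Ioi 0)) (nhds a) := by
  -- dyadic scale of `r`
  have hL2 : 0 < Real.log 2 := Real.log_pos (by norm_num)
  have hlogr : Tendsto (fun r : ℝ => -Real.log r / Real.log 2) (nhdsWithin 0 (Set.Ioi 0)) atTop :=
    (tendsto_neg_atBot_atTop.comp Real.tendsto_log_nhdsGT_zero).atTop_div_const hL2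
  set J : ℝ → ℕ := fun r => ⌊-Real.log r / Real.log 2⌋₊ with hJ
  have hJt : Tendsto J (nhdsWithin 0 (Set.Ioi 0)) atTop := tendsto_nat_floor_atTop.comp hlogr
  have hpos : ∀ᶠ r : ℝ in nhdsWithin 0 (Set.Ioi 0), 0 < r ∧ r < 1 := Ioo_mem_nhdsGT one_pos
  have e2 : ∀ j : ℕ, (1 / 2 : ℝ) ^ j = Real.exp (-(j * Real.log 2)) := by
    intro j
    rw [← two_rpow_neg_nat, Real.rpow_def_of_pos (by norm_num)]; congr 1; ring
  have hJ1 : ∀ r : ℝ, 0 < r → r < 1 → (J r : ℝ) * Real.log 2 ≤ -Real.log r ∧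
      -Real.log r < ((J r : ℝ) + 1) * Real.log 2 := by
    intro r h0 h1
    have hn : 0 ≤ -Real.log r / Real.log 2 := by
      have := Real.log_neg h0 h1
      exact div_nonneg (by linarith) hL2.le
    constructor
    · rw [← le_div_iff₀ hL2]; exact Nat.floor_le hn
    · rw [← div_lt_iff₀ hL2]; exact Nat.lt_floor_add_one _
  have hr1 : ∀ r : ℝ, 0 < r → r < 1 → r ≤ (1 / 2) ^ (J r) := by
    intro r h0 h1
    rw [e2, ← Real.log_le_iff_le_exp h0]
    linarith [(hJ1 r h0 h1).1]
  have hr2 : ∀ r : ℝ, 0 < r → r < 1 → (1 / 2) ^ (J r + 1) ≤ r := by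
    intro r h0 h1
    rw [e2, ← Real.le_log_iff_exp_le h0]
    push_cast
    linarith [(hJ1 r h0 h1).2]
  have hmem : ∀ᶠ r : ℝ in nhdsWithin 0 (Set.Ioi 0),
      1 ≤ hitBall (lsv a) xt r x ∧ circDist ((lsv a)^[hitBall (lsv a) xt r x] x) xt < r := by
    obtain ⟨β', _, _, h⟩ := hu (a + 1) (by linarith)
    have h' := ((tendsto_add_atTop_nat 1).comp hJt).eventually h
    filter_upwards [h', hpos] with r ⟨n, hn1, _, hn3⟩ hr
    have hne : {n : ℕ | 1 ≤ n ∧ circDist ((lsv a)^[n] x) xt < r}.Nonempty :=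
      ⟨n, hn1, hn3.trans_le (hr2 r hr.1 hr.2)⟩
    exact Nat.sInf_mem hne
  have hfloor : Tendsto (fun r => (J r : ℝ)) (nhdsWithin 0 (Set.Ioi 0)) atTop :=
    tendsto_natCast_atTop_atTop.comp hJt
  rw [tendsto_order]
  constructor
  · intro c hc
    obtain ⟨γ', hγ, h⟩ := hl (max c (1 / 2)) (lt_max_of_lt_right (by norm_num))
      (max_lt hc (by linarith))
    have hcγ : c < γ' := (le_max_left _ _).trans_lt hγ
    have hγ0 : 0 < γ' := lt_of_lt_of_le (by norm_num) ((le_max_right c (1 / 2)).trans hγ.le)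
    have h' := hJt.eventually h
    set c' := max c (1 / 2) with hc'
    have hc0 : 0 < c' := lt_max_of_lt_right (by norm_num)
    have hbig := hfloor.eventually_gt_atTop (c' / (γ' - c'))
    filter_upwards [h', hpos, hmem, hbig] with r hr hr0 hm hb
    obtain ⟨l1, l2⟩ := hJ1 r hr0.1 hr0.2
    have h3 := hr _ hm.1 (hm.2.trans_le (hr1 r hr0.1 hr0.2))
    have h4 := Real.log_le_log (by positivity) h3
    rw [Real.log_rpow (by norm_num)] at h4
    have hlr : 0 < -Real.log r := by linarith [Real.log_neg hr0.1 hr0.2]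
    refine (le_max_left c (1 / 2)).trans_lt ?_
    rw [lt_div_iff₀ hlr]
    rw [div_lt_iff₀ (by linarith)] at hb
    have h5 : c' * (-Real.log r) < c' * (((J r : ℝ) + 1) * Real.log 2) := by gcongr
    have h6 : c' * ((J r : ℝ) + 1) * Real.log 2 < γ' * J r * Real.log 2 :=
      mul_lt_mul_of_pos_right (by nlinarith) hL2
    nlinarith
  · intro c hc
    obtain ⟨β', hβ0, hβ, h⟩ := hu c hc
    have h' := ((tendsto_add_atTop_nat 1).comp hJt).eventually h
    have hbig := hfloor.eventually_gt_atTop ((β' + 1) / (c - β'))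
    filter_upwards [h', hpos, hmem, hbig] with r ⟨n, hn1, hn2, hn3⟩ hr0 hm hb
    obtain ⟨l1, l2⟩ := hJ1 r hr0.1 hr0.2
    have h3 : hitBall (lsv a) xt r x ≤ n := Nat.sInf_le ⟨hn1, hn3.trans_le (hr2 r hr0.1 hr0.2)⟩
    have h3' : (hitBall (lsv a) xt r x : ℝ) ≤ n := by exact_mod_cast h3
    have hp : (0:ℝ) < (hitBall (lsv a) xt r x : ℝ) := by
      have : (1:ℝ) ≤ (hitBall (lsv a) xt r x : ℝ) := by exact_mod_cast hm.1
      linarith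
    have h4 := Real.log_le_log hp (h3'.trans hn2)
    rw [Real.log_mul (by norm_num) (by positivity), Real.log_rpow (by norm_num)] at h4
    simp only [Function.comp] at h4
    push_cast at h4
    have hlr : 0 < -Real.log r := by linarith [Real.log_neg hr0.1 hr0.2]
    rw [div_lt_iff₀ hlr]
    rw [div_lt_iff₀ (by linarith)] at hb
    have h5 : c * ((J r : ℝ) * Real.log 2) ≤ c * (-Real.log r) := by gcongr; linarith
    have h6 : (β' * ((J r : ℝ) + 1) + 1) * Real.log 2 < c * J r * Real.log 2 :=
      mul_lt_mul_of_pos_right (by nlinarith) hL2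
    nlinarith

theorem lsv_main
    (a : ℝ) (ha : 1 ≤ a)
    (xt : ℝ) (hxt : xt ∈ Set.Ioc (1 / 2 : ℝ) 1) :
    ∀ᵐ x ∂(volume.restrict (Set.Ico (0 : ℝ) 1)),
      Tendsto (fun r : ℝ =>
          Real.log ((hitBall (lsv a) xt r x : ℕ) : ℝ) / (- Real.log r))
        (nhdsWithin 0 (Set.Ioi 0)) (nhds (max 1 a)) := by
  rw [max_eq_right ha, ae_restrict_iff' measurableSet_Ico]
  have h0 : ∀ᵐ x ∂(volume : Measure ℝ), x ≠ 0 := by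
    simp [ae_iff]
  have hL : ∀ᵐ x ∂(volume : Measure ℝ), ∀ k : ℕ, x ∈ II → ∀ᶠ j : ℕ in atTop, ∀ n : ℕ, 1 ≤ n →
      circDist ((lsv a)^[n] x) xt < (1 / 2) ^ j → (2:ℝ) ^ ((a - 1 / ((k:ℝ) + 2)) * j) ≤ n := by
    rw [ae_all_iff]
    intro k
    have h1 : (0:ℝ) < 1 / ((k:ℝ) + 2) := by positivity
    have h2 : 1 / ((k:ℝ) + 2) < 1 := by
      rw [div_lt_one (by positivity)]
      have : (0:ℝ) ≤ k := by positivity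
      linarith
    exact lower_ae ha hxt (by linarith) (by linarith)
  have hU : ∀ᵐ x ∂(volume : Measure ℝ), ∀ k : ℕ, x ∈ II → ∀ᶠ j : ℕ in atTop, ∃ n : ℕ, 1 ≤ n ∧
      (n:ℝ) ≤ 2 * (2:ℝ) ^ ((a + 1 / ((k:ℝ) + 1)) * j) ∧ circDist ((lsv a)^[n] x) xt < (1 / 2) ^ j := by
    rw [ae_all_iff]
    intro k
    have h1 : (0:ℝ) < 1 / ((k:ℝ) + 1) := by positivity
    exact upper_ae ha hxt (by linarith)
  filter_upwards [h0, hL, hU] with x hx0 hxL hxU hx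
  have hxI : x ∈ II := ⟨lt_of_le_of_ne hx.1 (Ne.symm hx0), hx.2⟩
  refine log_final ha ?_ ?_
  · intro γ _ hγ
    obtain ⟨k, hk⟩ := exists_nat_one_div_lt (sub_pos.2 hγ)
    refine ⟨a - 1 / ((k:ℝ) + 2), ?_, hxL k hxI⟩
    have : 1 / ((k:ℝ) + 2) ≤ 1 / ((k:ℝ) + 1) := by gcongr; norm_num
    linarith
  · intro β hβ
    obtain ⟨k, hk⟩ := exists_nat_one_div_lt (sub_pos.2 hβ)
    refine ⟨a + 1 / ((k:ℝ) + 1), by positivity, by linarith, hxU k hxI⟩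

/-- Corollary: anomalous logarithm law for hitting times of the intermittent
map with `α ≥ 1`: `log τ_r(x,x̃)/(−log r) → max(1,α) = α` for Lebesgue-a.e. `x`,
for targets around `x̃ ∈ (1/2,1]`. -/
theorem lsv_hitting_time_loglaw
    (a : ℝ) (ha : 1 ≤ a)
    (xt : ℝ) (hxt : xt ∈ Set.Ioc (1 / 2 : ℝ) 1) :
    ∀ᵐ x ∂(volume.restrict (Set.Ico (0 : ℝ) 1)),
      Tendsto (fun r : ℝ =>
          Real.log ((hitBall (lsv a) xt r x : ℕ) : ℝ) / (- Real.log r))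
        (nhdsWithin 0 (Set.Ioi 0)) (nhds (max 1 a)) := by
  exact lsv_main a ha xt hxt
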